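/- arXiv:1809.05312 — 7 statements merged into one kernel-verified Lean document; each statement's English description precedes it below -/
import Mathlib

section
/- Let X and Y be finite-dimensional Euclidean spaces (of the same dimension) and let f : X → Y be a C¹-mapping such that (1) the Fréchet derivative f'(x) is an invertible linear map for every x ∈ X, and (2) ‖f(x)‖ → ∞ as ‖x‖ → ∞. Then f is a diffeomorphism, i.e. f is a bijection and its inverse f⁻¹ : Y → X is continuously differentiable. -/
namespace IsCoveringMap

variable {E B : Type*} [TopologicalSpace E] [TopologicalSpace B] {p : E → B}

/-- A covering map from a nonempty connected space to a simply connected, locally path-connected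
space has a continuous two-sided inverse. -/
theorem exists_continuous_inverse [ConnectedSpace E] [SimplyConnectedSpace B]
    [LocallyPathConnectedSpace B] (hp : IsCoveringMap p) :
    ∃ g : B → E, Continuous g ∧ Function.LeftInverse g p ∧ Function.RightInverse g p := by
  obtain ⟨e⟩ : Nonempty E := inferInstance
  obtain ⟨g, ⟨hge, hg⟩, -⟩ :=
    hp.existsUnique_continuousMap_lifts (ContinuousMap.id B) (p e) e rfl
  have hright : Function.RightInverse g p := congrFun hg
  refine ⟨g, g.continuous, ?_, hright⟩
  exact congrFun <| hp.eq_of_comp_eq (g.continuous.comp hp.continuous) continuous_id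
    (funext fun x => hright (p x)) e hge

end IsCoveringMap

/-- A proper local homeomorphism from a Hausdorff space is a covering map. -/
theorem IsProperMap.isCoveringMap_of_isLocalHomeomorph {E B : Type*} [TopologicalSpace E]
    [TopologicalSpace B] [T2Space E] [T1Space B] {f : E → B} (hf : IsProperMap f)
    (h : IsLocalHomeomorph f) : IsCoveringMap f := by
  rw [isCoveringMap_iff_isCoveringMapOn_univ]
  refine hf.isClosedMap.isCoveringMapOn_of_isLocalHomeomorphOn (fun y _ => ?_)
    h.isLocalHomeomorphOn
  refine (hf.isCompact_preimage isCompact_singleton).finite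
    (.of_openPartialHomeomorph f subset_rfl fun x _ => ?_)
  obtain ⟨φ, hx, hφ⟩ := h x
  exact ⟨φ, hx, hφ.symm⟩

/-- **Hadamard Theorem** (Theorem 2.1 of the paper).
Let `X`, `Y` be finite-dimensional Euclidean spaces (of the same dimension) and let
`f : X → Y` be a `C¹`-mapping such that the Fréchet derivative `f'(x)` is an invertible
(continuous) linear map for every `x ∈ X`, and `‖f(x)‖ → ∞` as `‖x‖ → ∞`.
Then `f` is a diffeomorphism: `f` is a bijection and its inverse is `C¹`. -/
theorem hadamard_global_diffeomorphism
    {X Y : Type*}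
    [NormedAddCommGroup X] [InnerProductSpace ℝ X] [FiniteDimensional ℝ X]
    [NormedAddCommGroup Y] [InnerProductSpace ℝ Y] [FiniteDimensional ℝ Y]
    (hdim : Module.finrank ℝ X = Module.finrank ℝ Y)
    (f : X → Y)
    (hf : ContDiff ℝ 1 f)
    (hinv : ∀ x : X, Function.Bijective (fderiv ℝ f x))
    (hcoer : Filter.Tendsto (fun x => ‖f x‖)
      (Filter.comap (fun x : X => ‖x‖) Filter.atTop) Filter.atTop) :
    Function.Bijective f ∧
      ∃ g : Y → X, Function.LeftInverse g f ∧ Function.RightInverse g f ∧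
        ContDiff ℝ 1 g := by
  have : ProperSpace X := FiniteDimensional.proper_real X
  have : ProperSpace Y := FiniteDimensional.proper_real Y
  have hderiv (x : X) : ∃ f' : X ≃L[ℝ] Y, HasFDerivAt f (f' : X →L[ℝ] Y) x :=
    ⟨(LinearEquiv.ofBijective (fderiv ℝ f x : X →ₗ[ℝ] Y) (hinv x)).toContinuousLinearEquiv,
      (hf.differentiable one_ne_zero x).hasFDerivAt⟩
  choose f' hf' using hderiv
  have hproper : IsProperMap f := by
    refine isProperMap_iff_tendsto_cocompact.2 ⟨hf.continuous, ?_⟩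
    rw [← Metric.cobounded_eq_cocompact, ← Metric.cobounded_eq_cocompact,
      ← tendsto_norm_atTop_iff_cobounded, ← comap_norm_atTop]
    exact hcoer
  have hlocal : IsLocalHomeomorph f := fun x =>
    ⟨hf.contDiffAt.toOpenPartialHomeomorph f (hf' x) one_ne_zero,
      hf.contDiffAt.mem_toOpenPartialHomeomorph_source (hf' x) one_ne_zero, rfl⟩
  obtain ⟨g, hg, hleft, hright⟩ :=
    (hproper.isCoveringMap_of_isLocalHomeomorph hlocal).exists_continuous_inverse
  let e : X ≃ₜ Y := ⟨⟨f, g, hleft, hright⟩, hf.continuous, hg⟩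
  exact ⟨e.bijective, g, hleft, hright, e.contDiff_symm hf' hf⟩
end

section
/- Suppose a C¹-functional f : ℝⁿ → ℝ is coercive and possesses two distinct strict relative minima x₁ and x₂. Then f possesses a third critical point x₃, distinct from x₁ and x₂, which is not a relative minimizer; that is, in every neighborhood of x₃ there exists a point x such that f(x) < f(x₃). -/
open Set Filter Topology Metric

/-- The levels `c` such that `a` and `b` lie in a common compact connected subset of the
sublevel set `{x | f x ≤ c}`. -/
def continuumLevels {E : Type*} [TopologicalSpace E] (f : E → ℝ) (a b : E) : Set ℝ :=
  {c | ∃ T : Set E, IsPreconnected T ∧ IsCompact T ∧ a ∈ T ∧ b ∈ T ∧ ∀ x ∈ T, f x ≤ c}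

lemma continuumLevels_comm {E : Type*} [TopologicalSpace E] (f : E → ℝ) (a b : E) :
    continuumLevels f a b = continuumLevels f b a := by
  ext c
  constructor <;> rintro ⟨T, h, hc, h1, h2, h3⟩ <;> exact ⟨T, h, hc, h2, h1, h3⟩

lemma continuumLevels_nonempty {E : Type*} [NormedAddCommGroup E] [NormedSpace ℝ E]
    {f : E → ℝ} (hf : Continuous f) (a b : E) : (continuumLevels f a b).Nonempty := by
  have hK : IsCompact (segment ℝ a b) := by
    rw [segment_eq_image_lineMap]
    exact isCompact_Icc.image AffineMap.lineMap_continuous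
  obtain ⟨M, hM⟩ := hK.bddAbove_image hf.continuousOn
  exact ⟨M, segment ℝ a b, (convex_segment a b).isPreconnected, hK, left_mem_segment ℝ a b,
    right_mem_segment ℝ a b, fun x hx => hM (mem_image_of_mem f hx)⟩

lemma bddBelow_continuumLevels {E : Type*} [TopologicalSpace E] (f : E → ℝ) (a b : E) :
    BddBelow (continuumLevels f a b) :=
  ⟨f a, fun _ ⟨_, _, _, ha, _, h⟩ => h a ha⟩

/-- A continuum joining a strict local minimum to another point climbs strictly above it. -/
lemma lt_sInf_continuumLevels {E : Type*} [NormedAddCommGroup E] [NormedSpace ℝ E]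
    [ProperSpace E] {f : E → ℝ} (hf : Continuous f) {a b : E} (hne : a ≠ b)
    (hmin : ∃ U ∈ 𝓝 a, ∀ x ∈ U, x ≠ a → f a < f x) :
    f a < sInf (continuumLevels f a b) := by
  obtain ⟨U, hU, hlt⟩ := hmin
  obtain ⟨ε, hε, hεU⟩ := Metric.mem_nhds_iff.1 hU
  have hab : 0 < dist b a := dist_pos.2 hne.symm
  obtain ⟨r, hr, hr'⟩ := exists_between (lt_min hε hab)
  have hcross : ∀ T : Set E, IsPreconnected T → a ∈ T → b ∈ T → ∃ x ∈ T, x ∈ sphere a r := by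
    intro T hT ha hb
    have h := hT.intermediate_value ha hb (f := fun x => dist x a) (by fun_prop)
    obtain ⟨x, hx, hxr⟩ := h ⟨by simpa using hr.le, (hr'.trans_le (min_le_right _ _)).le⟩
    exact ⟨x, hx, hxr⟩
  obtain ⟨z, -, hz⟩ := hcross univ isPreconnected_univ trivial trivial
  obtain ⟨s, hs, hsmin⟩ := (isCompact_sphere a r).exists_isMinOn ⟨z, hz⟩ hf.continuousOn
  have hfs : f a < f s := hlt s
    (hεU (by rw [mem_ball, mem_sphere.1 hs]; exact hr'.trans_le (min_le_left _ _)))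
    (ne_of_mem_sphere hs hr.ne')
  refine hfs.trans_le (le_csInf (continuumLevels_nonempty hf a b) ?_)
  rintro c ⟨T, hT, -, ha, hb, hc⟩
  obtain ⟨x, hxT, hx⟩ := hcross T hT ha hb
  exact (hsmin hx).trans (hc x hxT)

/-- Near a regular boundary point of a component `V` of the strict sublevel set, the sublevel set
is contained in the closure of `V`. -/
lemma eventually_mem_closure_connectedComponentIn {E : Type*} [NormedAddCommGroup E]
    [NormedSpace ℝ E] {f : E → ℝ} (hf : ContDiff ℝ 1 f) {a y : E} (hy : fderiv ℝ f y ≠ 0)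
    (hcl : y ∈ closure (connectedComponentIn {x | f x < f y} a)) :
    ∀ᶠ x in 𝓝 y, f x ≤ f y → x ∈ closure (connectedComponentIn {x | f x < f y} a) := by
  obtain ⟨v, hv⟩ : ∃ v, fderiv ℝ f y v < 0 := by
    obtain ⟨w, hw⟩ := DFunLike.ne_iff.1 hy
    rcases lt_or_gt_of_ne hw with h | h
    · exact ⟨w, h⟩
    · exact ⟨-w, by simpa using h⟩
  have hdcont : Continuous fun x => fderiv ℝ f x v :=
    (hf.continuous_fderiv one_ne_zero).clm_apply continuous_const
  obtain ⟨r, hr, hneg⟩ := Metric.eventually_nhds_iff_ball.1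
    (hdcont.continuousAt.eventually (gt_mem_nhds hv))
  set s : ℝ := r / (2 * (‖v‖ + 1)) with hs_def
  have hs : 0 < s := by positivity
  have hsv : s * ‖v‖ < r / 2 := by
    rw [hs_def, div_mul_eq_mul_div, div_lt_iff₀ (by positivity)]
    nlinarith
  have hmem : ∀ x ∈ ball y (r / 2), ∀ t ∈ Icc 0 s, x + t • v ∈ ball y r := by
    intro x hx t ht
    rw [mem_ball_iff_norm] at hx ⊢
    have h1 : ‖t • v‖ ≤ s * ‖v‖ := by
      rw [norm_smul, Real.norm_of_nonneg ht.1]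
      gcongr
      exact ht.2
    calc ‖x + t • v - y‖ = ‖(x - y) + t • v‖ := by congr 1; abel
      _ ≤ ‖x - y‖ + ‖t • v‖ := norm_add_le _ _
      _ < r := by linarith
  have hanti : ∀ x ∈ ball y (r / 2), StrictAntiOn (fun t : ℝ => f (x + t • v)) (Icc 0 s) := by
    intro x hx
    have hfc := hf.continuous
    refine strictAntiOn_of_deriv_neg (convex_Icc 0 s) (by fun_prop) fun t ht => ?_
    have hl : HasDerivAt (fun t : ℝ => x + t • v) v t := by
      simpa using ((hasDerivAt_id t).smul_const v).const_add x
    have hd : HasDerivAt (fun t : ℝ => f (x + t • v)) (fderiv ℝ f (x + t • v) v) t :=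
      ((hf.differentiable one_ne_zero _).hasFDerivAt).comp_hasDerivAt t hl
    rw [hd.deriv]
    exact hneg _ (hmem x hx t (interior_subset ht))
  have hlow : ∀ x ∈ ball y (r / 2), f x ≤ f y → ∀ t ∈ Ioc 0 s, f (x + t • v) < f y := by
    intro x hx hxy t ht
    have h := hanti x hx (left_mem_Icc.2 hs.le) (Ioc_subset_Icc_self ht) ht.1
    simp only [zero_smul, add_zero] at h
    exact h.trans_le hxy
  have hopen : IsOpen {x | f x < f y} := isOpen_lt hf.continuous continuous_const
  obtain ⟨ρ, hρ, hball⟩ := Metric.isOpen_iff.1 hopen (y + s • v)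
    (hlow y (mem_ball_self (by positivity)) le_rfl s ⟨hs, le_rfl⟩)
  set δ := min ρ (r / 2)
  have hδ : 0 < δ := lt_min hρ (by positivity)
  have hδr : ball y δ ⊆ ball y (r / 2) := ball_subset_ball (min_le_right _ _)
  have hBsub : ball (y + s • v) δ ⊆ {x | f x < f y} :=
    (ball_subset_ball (min_le_left _ _)).trans hball
  have hend : ∀ x ∈ ball y δ, x + s • v ∈ ball (y + s • v) δ := by
    intro x hx
    simpa [mem_ball] using hx
  have hline : ∀ x : E, Continuous fun t : ℝ => x + t • v := fun x => by fun_prop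
  obtain ⟨z, hzδ, hzV⟩ := mem_closure_iff_nhds.1 hcl _ (ball_mem_nhds y hδ)
  have hzlt : f z < f y := connectedComponentIn_subset {x | f x < f y} a hzV
  have hcompz := connectedComponentIn_eq hzV
  filter_upwards [ball_mem_nhds y hδ] with x hx hxy
  have hZ : IsPreconnected ((fun t : ℝ => z + t • v) '' Icc 0 s) :=
    isPreconnected_Icc.image _ (hline z).continuousOn
  have hX : IsPreconnected ((fun t : ℝ => x + t • v) '' Ioc 0 s) :=
    isPreconnected_Ioc.image _ (hline x).continuousOn
  have hZend : z + s • v ∈ (fun t : ℝ => z + t • v) '' Icc 0 s := ⟨s, right_mem_Icc.2 hs.le, rfl⟩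
  have hXend : x + s • v ∈ (fun t : ℝ => x + t • v) '' Ioc 0 s := ⟨s, right_mem_Ioc.2 hs, rfl⟩
  have hZB := IsPreconnected.union (z + s • v) hZend (hend z hzδ) hZ
    (convex_ball (y + s • v) δ).isPreconnected
  have hW := IsPreconnected.union (x + s • v) (mem_union_right _ (hend x hx)) hXend hZB hX
  have hWsub := hW.subset_connectedComponentIn (x := z) (F := {x | f x < f y})
    (Or.inl (Or.inl ⟨0, left_mem_Icc.2 hs.le, by simp⟩)) (by
      rintro w ((⟨t, ht, rfl⟩ | hw) | ⟨t, ht, rfl⟩)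
      · rcases ht.1.eq_or_lt with rfl | h0
        · simpa using hzlt
        · exact hlow z (hδr hzδ) hzlt.le t ⟨h0, ht.2⟩
      · exact hBsub hw
      · exact hlow x (hδr hx) hxy t ht)
  rw [hcompz]
  have hlim : Tendsto (fun t : ℝ => x + t • v) (𝓝[>] 0) (𝓝 x) := by
    have h := (hline x).tendsto 0
    simp only [zero_smul, add_zero] at h
    exact h.mono_left nhdsWithin_le_nhds
  refine mem_closure_of_tendsto hlim ?_
  filter_upwards [Ioc_mem_nhdsGT hs] with t ht
  exact hWsub (Or.inr ⟨t, ht, rfl⟩)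

/-- Components are relatively closed. -/
lemma mem_connectedComponentIn_of_mem_closure {E : Type*} [TopologicalSpace E] {F : Set E}
    {a y : E} (hy : y ∈ F) (ha : a ∈ F) (hcl : y ∈ closure (connectedComponentIn F a)) :
    y ∈ connectedComponentIn F a := by
  have h : IsPreconnected (insert y (connectedComponentIn F a)) :=
    isPreconnected_connectedComponentIn.subset_closure (subset_insert _ _)
      (insert_subset hcl subset_closure)
  exact h.subset_connectedComponentIn (mem_insert_of_mem _ (mem_connectedComponentIn ha))
    (insert_subset hy (connectedComponentIn_subset _ _)) (mem_insert _ _)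

/-- Below the minimax level, `a` and `b` lie in different components. -/
lemma notMem_connectedComponentIn_lt_sInf {E : Type*} [NormedAddCommGroup E] [NormedSpace ℝ E]
    {f : E → ℝ} (hf : Continuous f) {a b : E} (ha : f a < sInf (continuumLevels f a b)) :
    b ∉ connectedComponentIn {x | f x < sInf (continuumLevels f a b)} a := by
  intro hb
  have hopen : IsOpen {x | f x < sInf (continuumLevels f a b)} := isOpen_lt hf continuous_const
  have hpath := hopen.connectedComponentIn.isConnected_iff_isPathConnected.1
    (isConnected_connectedComponentIn_iff.2 ha)
  obtain ⟨γ, hγ⟩ := hpath.joinedIn a (mem_connectedComponentIn ha) b hb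
  obtain ⟨t, -, ht⟩ := isCompact_univ.exists_isMaxOn univ_nonempty
    (hf.comp γ.continuous).continuousOn
  have hmem : f (γ t) ∈ continuumLevels f a b := by
    refine ⟨range γ, isPreconnected_range γ.continuous, isCompact_range γ.continuous,
      ⟨0, γ.source⟩, ⟨1, γ.target⟩, ?_⟩
    rintro _ ⟨u, rfl⟩
    exact ht (mem_univ u)
  have hlt : f (γ t) < sInf (continuumLevels f a b) :=
    connectedComponentIn_subset {x | f x < sInf (continuumLevels f a b)} a (hγ t)
  exact absurd (csInf_le (bddBelow_continuumLevels f a b) hmem) (not_le.2 hlt)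

/-- The sublevel set at the minimax level cannot be split by a closed, relatively open subset
separating `a` from `b`. -/
lemma not_separated_sInf_continuumLevels {E : Type*} [NormedAddCommGroup E] [NormedSpace ℝ E]
    {f : E → ℝ} (hf : Continuous f) (hcpt : ∀ c, IsCompact {x | f x ≤ c}) {a b : E} {A : Set E}
    (hA : IsClosed A) (hsub : A ⊆ {x | f x ≤ sInf (continuumLevels f a b)})
    (hnear : ∀ y ∈ A, ∀ᶠ x in 𝓝 y, f x ≤ sInf (continuumLevels f a b) → x ∈ A)
    (ha : a ∈ A) (hb : b ∉ A) (hfb : f b ≤ sInf (continuumLevels f a b)) : False := by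
  set β := sInf (continuumLevels f a b) with hβ
  have hAc : IsCompact A := (hcpt β).of_isClosed_subset hA hsub
  have hBc : IsCompact ({x | f x ≤ β} \ A) := by
    have h : {x | f x ≤ β} \ A = {x | f x ≤ β} \ interior {x | f x ≤ β → x ∈ A} := by
      ext x
      constructor
      · rintro ⟨hx, hxA⟩
        exact ⟨hx, fun hi => hxA (interior_subset hi hx)⟩
      · rintro ⟨hx, hxi⟩
        exact ⟨hx, fun hxA => hxi (mem_interior_iff_mem_nhds.2 (hnear x hxA))⟩
    rw [h]
    exact (hcpt β).diff isOpen_interior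
  obtain ⟨O₁, O₂, hO₁, hO₂, hAO, hBO, hdisj⟩ :=
    SeparatedNhds.of_isCompact_isCompact hAc hBc disjoint_sdiff_right
  have hL : IsCompact ({x | f x ≤ β + 1} \ (O₁ ∪ O₂)) := (hcpt _).diff (hO₁.union hO₂)
  obtain ⟨c, hc, hcL⟩ : ∃ c > β, ∀ x ∈ {x | f x ≤ β + 1} \ (O₁ ∪ O₂), c ≤ f x := by
    rcases eq_empty_or_nonempty ({x | f x ≤ β + 1} \ (O₁ ∪ O₂)) with h | h
    · exact ⟨β + 1, lt_add_one β, by simp [h]⟩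
    · obtain ⟨m, hm, hmin⟩ := hL.exists_isMinOn h hf.continuousOn
      refine ⟨f m, lt_of_not_ge fun hle => hm.2 ?_, fun x hx => hmin hx⟩
      by_cases hmA : m ∈ A
      · exact Or.inl (hAO hmA)
      · exact Or.inr (hBO ⟨hle, hmA⟩)
  obtain ⟨d, ⟨T, hT, -, haT, hbT, hTd⟩, hd⟩ := exists_lt_of_csInf_lt
    (continuumLevels_nonempty hf a b) (show β < min c (β + 1) from lt_min hc (lt_add_one β))
  have hTO : T ⊆ O₁ ∪ O₂ := by
    intro x hx
    by_contra hxO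
    have h1 : f x < min c (β + 1) := (hTd x hx).trans_lt hd
    exact (h1.trans_le (min_le_left _ _)).not_ge
      (hcL x ⟨(h1.trans_le (min_le_right _ _)).le, hxO⟩)
  have hTO₁ := hT.subset_left_of_subset_union hO₁ hO₂ hdisj hTO ⟨a, haT, hAO ha⟩
  exact disjoint_left.1 hdisj (hTO₁ hbT) (hBO ⟨hfb, hb⟩)


/-- **Finite-Dimensional Mountain Pass Theorem** (Courant; Theorem 2.2 of the paper).
Suppose a `C¹`-functional `f : ℝⁿ → ℝ` is coercive and possesses two distinct strict relative
minima `x₁` and `x₂`. Then `f` possesses a third critical point `x₃`, distinct from `x₁` and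
`x₂`, which is not a relative minimizer: in every neighborhood of `x₃` there exists a point `x`
with `f(x) < f(x₃)`. -/
theorem finite_dimensional_mountain_pass
    {n : ℕ} (f : EuclideanSpace ℝ (Fin n) → ℝ)
    (hf : ContDiff ℝ 1 f)
    (hcoer : Filter.Tendsto f
      (Filter.comap (fun x : EuclideanSpace ℝ (Fin n) => ‖x‖) Filter.atTop) Filter.atTop)
    (x₁ x₂ : EuclideanSpace ℝ (Fin n)) (hne : x₁ ≠ x₂)
    (hmin₁ : ∃ U ∈ nhds x₁, ∀ x ∈ U, x ≠ x₁ → f x₁ < f x)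
    (hmin₂ : ∃ U ∈ nhds x₂, ∀ x ∈ U, x ≠ x₂ → f x₂ < f x) :
    ∃ x₃ : EuclideanSpace ℝ (Fin n), x₃ ≠ x₁ ∧ x₃ ≠ x₂ ∧ fderiv ℝ f x₃ = 0 ∧
      ∀ U ∈ nhds x₃, ∃ x ∈ U, f x < f x₃ := by
  have hcont := hf.continuous
  have hcpt : ∀ c, IsCompact {x | f x ≤ c} := by
    intro c
    rw [comap_norm_atTop, Metric.cobounded_eq_cocompact] at hcoer
    obtain ⟨K, hK, hsub⟩ := mem_cocompact.1 (hcoer.eventually (eventually_gt_atTop c))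
    exact hK.of_isClosed_subset (isClosed_le hcont continuous_const)
      fun x hx => by_contra fun hxK => not_lt.2 (show f x ≤ c from hx) (hsub hxK)
  have h₁ := lt_sInf_continuumLevels hcont hne hmin₁
  have h₂ := lt_sInf_continuumLevels hcont hne.symm hmin₂
  rw [continuumLevels_comm] at h₂
  have hnot := notMem_connectedComponentIn_lt_sInf hcont h₁
  by_contra! hno
  have hsub : closure (connectedComponentIn {x | f x < sInf (continuumLevels f x₁ x₂)} x₁) ⊆
      {x | f x ≤ sInf (continuumLevels f x₁ x₂)} :=
    closure_minimal ((connectedComponentIn_subset _ _).trans fun x (hx : f x < _) => hx.le)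
      (isClosed_le hcont continuous_const)
  refine not_separated_sInf_continuumLevels hcont hcpt isClosed_closure hsub ?_
    (subset_closure (mem_connectedComponentIn h₁))
    (fun h => hnot (mem_connectedComponentIn_of_mem_closure h₂ h₁ h)) h₂.le
  intro y hy
  have hle : f y ≤ _ := hsub hy
  rcases hle.lt_or_eq with hlt | heq
  · have hopen : IsOpen {x | f x < sInf (continuumLevels f x₁ x₂)} :=
      isOpen_lt hcont continuous_const
    filter_upwards [hopen.connectedComponentIn.mem_nhds
      (mem_connectedComponentIn_of_mem_closure hlt h₁ hy)] with x hx _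
    exact subset_closure hx
  · rw [← heq] at h₁ h₂ hy ⊢
    refine eventually_mem_closure_connectedComponentIn hf (fun hcrit => ?_) hy
    obtain ⟨U, hU, hUmin⟩ := hno y (fun h => h₁.ne (by rw [h])) (fun h => h₂.ne (by rw [h])) hcrit
    obtain ⟨z, hzU, hz⟩ := mem_closure_iff_nhds.1 hy U hU
    exact (hUmin z hzU).not_gt (connectedComponentIn_subset {x | f x < f y} x₁ hz)
end

section
/- Let E be a real Banach space and let J : E → ℝ be a C¹-functional which is bounded from below and satisfies the Palais–Smale condition. Then J is coercive, i.e. J(x) → +∞ as ‖x‖ → ∞. -/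
/-- **Ekeland's variational principle**: a lower semicontinuous function bounded below on a complete
metric space has, below any given point, a point at which it decreases with slope at most `ε`. -/
theorem LowerSemicontinuous.exists_ekeland {X : Type*} [MetricSpace X] [CompleteSpace X]
    {f : X → ℝ} (hf : LowerSemicontinuous f) (hbdd : BddBelow (Set.range f)) {ε : ℝ} (hε : 0 < ε)
    (x : X) : ∃ y, f y + ε * dist y x ≤ f x ∧ ∀ z, f y ≤ f z + ε * dist z y := by
  let S : X → Set X := fun a => {z | f z + ε * dist z a ≤ f a}
  have mem_self (a) : a ∈ S a := by simp [S]
  have trans {a b c} (hb : b ∈ S a) (hc : c ∈ S b) : c ∈ S a := by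
    simp only [S, Set.mem_ofPred_eq] at *
    have := mul_le_mul_of_nonneg_left (dist_triangle c b a) hε.le
    linarith
  have isClosed (a) : IsClosed (S a) :=
    (hf.add (g := fun z => ε * dist z a)
      (Continuous.lowerSemicontinuous (by fun_prop))).isClosed_preimage (f a)
  have next (k : ℕ) (a : X) : ∃ b ∈ S a, ∀ z ∈ S a, f b ≤ f z + (1 / 2) ^ k := by
    obtain ⟨_, ⟨b, hb, rfl⟩, hlt⟩ := exists_lt_of_csInf_lt (Set.Nonempty.image f ⟨a, mem_self a⟩)
      (lt_add_of_pos_right (sInf (f '' S a)) (by positivity : (0 : ℝ) < (1 / 2) ^ k))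
    refine ⟨b, hb, fun z hz => ?_⟩
    have := csInf_le (hbdd.mono (Set.image_subset_range f (S a))) (Set.mem_image_of_mem f hz)
    linarith
  choose g hgS hg using next
  let u : ℕ → X := fun n => Nat.rec x g n
  have mem_of_le {i j} (hij : i ≤ j) : u j ∈ S (u i) := by
    induction j, hij using Nat.le_induction with
    | base => exact mem_self _
    | succ j _ ih => exact trans ih (hgS j (u j))
  have dist_le (k : ℕ) (z) (hz : z ∈ S (u (k + 1))) :
      dist z (u (k + 1)) ≤ (1 / 2) ^ k / ε := by
    have h₁ : f (u (k + 1)) ≤ f z + (1 / 2) ^ k :=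
      hg k (u k) z (trans (mem_of_le (Nat.le_succ k)) hz)
    have h₂ : f z + ε * dist z (u (k + 1)) ≤ f (u (k + 1)) := hz
    rw [le_div_iff₀ hε]
    linarith
  have lim : Filter.Tendsto (fun k : ℕ => (1 / 2 : ℝ) ^ k / ε) Filter.atTop (nhds 0) := by
    simpa using (tendsto_pow_atTop_nhds_zero_of_lt_one (r := (1 / 2 : ℝ))
      (by norm_num) (by norm_num)).div_const ε
  have cauchy : CauchySeq fun k => u (k + 1) :=
    cauchySeq_of_le_tendsto_0' _
      (fun n m hnm => (dist_comm _ _).trans_le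
        (dist_le n (u (m + 1)) (mem_of_le (Nat.succ_le_succ hnm)))) lim
  obtain ⟨y, hy⟩ := cauchySeq_tendsto_of_complete cauchy
  have y_mem (k) : y ∈ S (u k) := (isClosed _).mem_of_tendsto hy <| by
    filter_upwards [Filter.eventually_ge_atTop k] with n hn using mem_of_le (Nat.le_succ_of_le hn)
  refine ⟨y, y_mem 0, fun z => ?_⟩
  by_contra! h
  have hz (k) : z ∈ S (u k) := trans (y_mem k) h.le
  have hzlim : Filter.Tendsto (fun k => u (k + 1)) Filter.atTop (nhds z) :=
    tendsto_iff_dist_tendsto_zero.2 <| squeeze_zero (fun _ => dist_nonneg)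
      (fun k => (dist_comm _ _).trans_le (dist_le k z (hz (k + 1)))) lim
  rw [tendsto_nhds_unique hzlim hy] at h
  simp at h

/-- If `f` decreases from `y` with slope at most `ε`, its derivative at `y` has norm at most `ε`. -/
theorem HasFDerivAt.norm_le_of_forall_le_add {E : Type*} [NormedAddCommGroup E] [NormedSpace ℝ E]
    {f : E → ℝ} {f' : E →L[ℝ] ℝ} {y : E} (hf : HasFDerivAt f f' y) {ε : ℝ} (hε : 0 ≤ ε)
    (h : ∀ z, f y ≤ f z + ε * dist z y) : ‖f'‖ ≤ ε := by
  have key (v : E) : -(ε * ‖v‖) ≤ f' v := by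
    refine ge_of_tendsto (hf.hasLineDerivAt v).tendsto_slope_zero_right ?_
    filter_upwards [self_mem_nhdsWithin] with t (ht : 0 < t)
    have := h (y + t • v)
    rw [dist_self_add_left, norm_smul, Real.norm_of_nonneg ht.le] at this
    rw [smul_eq_mul, inv_mul_eq_div, le_div_iff₀ ht]
    linarith
  refine f'.opNorm_le_bound hε fun v => abs_le.2 ⟨key v, ?_⟩
  have := key (-v)
  rw [norm_neg, map_neg] at this
  linarith

/-- (Proposition 3.1 of the paper.) Let `E` be a real Banach space and `J : E → ℝ`
a `C¹`-functional which is bounded from below and satisfies the Palais–Smale condition.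
Then `J` is coercive: `J(x) → +∞` as `‖x‖ → ∞`. -/
theorem bddBelow_palaisSmale_implies_coercive
    {E : Type*} [NormedAddCommGroup E] [NormedSpace ℝ E] [CompleteSpace E]
    (J : E → ℝ)
    (hJ : ContDiff ℝ 1 J)
    (hbdd : ∃ m : ℝ, ∀ x : E, m ≤ J x)
    (hPS : ∀ u : ℕ → E, (∃ M : ℝ, ∀ n : ℕ, |J (u n)| ≤ M) →
      Filter.Tendsto (fun n => ‖fderiv ℝ J (u n)‖) Filter.atTop (nhds 0) →
      ∃ v : E, ∃ φ : ℕ → ℕ, StrictMono φ ∧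
        Filter.Tendsto (u ∘ φ) Filter.atTop (nhds v)) :
    Filter.Tendsto J (Filter.comap (fun x : E => ‖x‖) Filter.atTop) Filter.atTop := by
  obtain ⟨m, hm⟩ := hbdd
  have bdd : BddBelow (Set.range J) := ⟨m, Set.forall_mem_range.2 hm⟩
  rw [Filter.tendsto_atTop]
  intro c
  by_contra hc
  have far (R : ℝ) : ∃ x, R ≤ ‖x‖ ∧ J x < c := by
    by_contra! h
    exact hc (Filter.mem_of_superset
      (Filter.preimage_mem_comap (Filter.eventually_ge_atTop R)) h)
  have hcm : 0 < c - m := by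
    obtain ⟨x, -, hx⟩ := far 0
    linarith [hm x]
  have almost_critical (n : ℕ) : ∃ y, (n : ℝ) ≤ ‖y‖ ∧ J y ≤ c ∧
      ‖fderiv ℝ J y‖ ≤ (c - m) / ((n : ℝ) + 1) := by
    obtain ⟨x, hxn, hxc⟩ := far (2 * n + 1)
    have hε : 0 < (c - m) / ((n : ℝ) + 1) := by positivity
    obtain ⟨y, hyx, hy⟩ := hJ.continuous.lowerSemicontinuous.exists_ekeland bdd hε x
    have hdist : dist y x ≤ n + 1 := by
      have : (c - m) / ((n : ℝ) + 1) * dist y x ≤ (c - m) / ((n : ℝ) + 1) * (n + 1) := by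
        rw [div_mul_cancel₀ _ (by positivity)]
        linarith [hm y]
      exact le_of_mul_le_mul_left this hε
    refine ⟨y, ?_, ?_, ?_⟩
    · rw [dist_comm, dist_eq_norm] at hdist
      linarith [norm_sub_norm_le x y]
    · linarith [mul_nonneg hε.le (dist_nonneg (x := y) (y := x))]
    · exact (hJ.differentiable one_ne_zero y).hasFDerivAt.norm_le_of_forall_le_add hε.le hy
  choose u hun huc hu using almost_critical
  obtain ⟨v, φ, hφ, hv⟩ := hPS u
    ⟨max |m| |c|, fun n => abs_le_max_abs_abs (hm _) (huc n)⟩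
    (squeeze_zero (fun _ => norm_nonneg _) hu
      (tendsto_const_nhds.div_atTop
        (Filter.tendsto_atTop_add_const_right _ _ tendsto_natCast_atTop_atTop)))
  exact not_tendsto_nhds_of_tendsto_atTop
    ((Filter.tendsto_atTop_mono hun tendsto_natCast_atTop_atTop).comp hφ.tendsto_atTop) _ hv.norm
end

section
/- Let X be a real Banach space and H a real Hilbert space. Let f : X → H be a C¹-mapping such that (1) for every y ∈ H the functional φ : X → ℝ given by φ(x) = (1/2)‖f(x) − y‖² satisfies the Palais–Smale condition, and (2) for every x ∈ X the Fréchet derivative f'(x) is a continuous linear bijection from X onto H. Then f is a diffeomorphism. -/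
open Filter Topology Set

/-- A weak form of Ekeland's variational principle. -/
theorem exists_le_forall_le_add_mul_dist {M : Type*} [PseudoMetricSpace M] [CompleteSpace M]
    {F : M → ℝ} (hF : Continuous F) (hb : BddBelow (range F)) {ε : ℝ} (hε : 0 < ε) (p₀ : M) :
    ∃ p, F p ≤ F p₀ ∧ ∀ q, F p ≤ F q + ε * dist q p := by
  have step : ∀ (n : ℕ) (p : M), ∃ q, F q + ε * dist q p ≤ F p ∧
      ∀ r, F r + ε * dist r p ≤ F p → F q ≤ F r + (1 / 2) ^ n := by
    intro n p
    set S : Set M := {q | F q + ε * dist q p ≤ F p}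
    have hne : (F '' S).Nonempty := ⟨F p, p, by simp [S], rfl⟩
    have hbS : BddBelow (F '' S) := hb.mono (image_subset_range _ _)
    obtain ⟨_, ⟨q, hq, rfl⟩, hlt⟩ :=
      exists_lt_of_csInf_lt hne (lt_add_of_pos_right (sInf (F '' S))
        (by positivity : (0 : ℝ) < (1 / 2) ^ n))
    refine ⟨q, hq, fun r hr => ?_⟩
    have := csInf_le hbS (mem_image_of_mem F (show r ∈ S from hr))
    linarith
  choose next hnext hmin using step
  let u : ℕ → M := fun n => Nat.rec p₀ next n
  have hu : ∀ n, u (n + 1) = next n (u n) := fun _ => rfl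
  have trans : ∀ {p q r : M}, F q + ε * dist q p ≤ F p → F r + ε * dist r q ≤ F q →
      F r + ε * dist r p ≤ F p := by
    intro p q r h₁ h₂
    have := mul_le_mul_of_nonneg_left (dist_triangle r q p) hε.le
    linarith
  have hmono : ∀ n m, n ≤ m → F (u m) + ε * dist (u m) (u n) ≤ F (u n) := by
    intro n m hnm
    induction m, hnm using Nat.le_induction with
    | base => simp
    | succ m _ ih => exact trans ih (hu m ▸ hnext m (u m))
  have hanti : Antitone (F ∘ u) := fun n m hnm => by
    have h₁ := hmono n m hnm
    have h₂ : 0 ≤ ε * dist (u m) (u n) := by positivity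
    simp only [Function.comp_apply]
    linarith
  have hbu : BddBelow (range (F ∘ u)) := hb.mono (range_comp_subset_range u F)
  have hlim := tendsto_atTop_ciInf hanti hbu
  have hcauchy : CauchySeq u := by
    refine cauchySeq_of_le_tendsto_0' (fun n => (F (u n) - ⨅ i, (F ∘ u) i) / ε) ?_ ?_
    · intro n m hnm
      rw [le_div_iff₀ hε, dist_comm, mul_comm]
      have h₁ := hmono n m hnm
      have h₂ : (⨅ i, (F ∘ u) i) ≤ F (u m) := ciInf_le hbu m
      linarith
    · simpa using (hlim.sub_const (⨅ i, (F ∘ u) i)).div_const ε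
  obtain ⟨p, hp⟩ := cauchySeq_tendsto_of_complete hcauchy
  have hFp : Tendsto (fun n => F (u n)) atTop (𝓝 (F p)) := (hF.tendsto p).comp hp
  have hpu : ∀ n, F p + ε * dist p (u n) ≤ F (u n) := fun n =>
    le_of_tendsto (hFp.add ((hp.dist tendsto_const_nhds).const_mul ε))
      (eventually_atTop.2 ⟨n, fun m hm => hmono n m hm⟩)
  refine ⟨p, ?_, fun q => ?_⟩
  · have h₁ : F p + ε * dist p p₀ ≤ F p₀ := hpu 0
    have h₂ : 0 ≤ ε * dist p p₀ := by positivity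
    linarith
  · by_contra! hq
    have hle : F p ≤ F q + 0 := by
      refine le_of_tendsto_of_tendsto' (hFp.comp (tendsto_add_atTop_nat 1))
        (tendsto_const_nhds.add (tendsto_pow_atTop_nhds_zero_of_lt_one
          (by norm_num : (0 : ℝ) ≤ 1 / 2) (by norm_num))) fun n => ?_
      simp only [Function.comp_apply, hu]
      exact hmin n (u n) q (trans (hpu n) hq.le)
    have : 0 ≤ ε * dist q p := by positivity
    linarith

/-- If moving a compact family of points against a continuous vector field `v` decreases the
maximum of `φ` at a rate at most `ε`, then `φ` has slope at most `ε` in the direction of `v` at some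
maximum point of the family. -/
theorem exists_forall_le_and_fderiv_apply_le {X K : Type*} [NormedAddCommGroup X]
    [NormedSpace ℝ X] [PseudoMetricSpace K] [CompactSpace K] [Nonempty K] {φ : X → ℝ}
    (hφ : ContDiff ℝ 1 φ) {v : X → X} (hv : Continuous v) {p : K → X} (hp : Continuous p) {ε : ℝ}
    (h : ∀ s > 0, ∀ t, ∃ t', φ (p t) ≤ φ (p t' - s • v (p t')) + ε * s) :
    ∃ t, (∀ t', φ (p t') ≤ φ (p t)) ∧ fderiv ℝ φ (p t) (v (p t)) ≤ ε := by
  have hφc := hφ.continuous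
  obtain ⟨m, -, hm⟩ := isCompact_univ.exists_isMaxOn univ_nonempty (hφc.comp hp).continuousOn
  have hm' : ∀ t, φ (p t) ≤ φ (p m) := fun t => hm (mem_univ t)
  choose! τ hτ using fun s hs => h s hs m
  obtain ⟨t, -, ψ, hψ, ht⟩ := isCompact_univ.tendsto_subseq
    (x := fun n : ℕ => τ (1 / ((n : ℝ) + 1))) fun _ => mem_univ _
  set s : ℕ → ℝ := fun n => 1 / ((ψ n : ℝ) + 1) with hs
  have hs0 : ∀ n, 0 < s n := fun n => by positivity
  have hslim : Tendsto s atTop (𝓝 0) :=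
    (tendsto_one_div_add_atTop_nhds_zero_nat (𝕜 := ℝ)).comp hψ.tendsto_atTop
  have ht' : Tendsto (fun n => τ (s n)) atTop (𝓝 t) := ht
  have hb : Tendsto (fun n => p (τ (s n))) atTop (𝓝 (p t)) := (hp.tendsto t).comp ht'
  have hw : Tendsto (fun n => v (p (τ (s n)))) atTop (𝓝 (v (p t))) := (hv.tendsto _).comp hb
  have ha : Tendsto (fun n => p (τ (s n)) - s n • v (p (τ (s n)))) atTop (𝓝 (p t)) := by
    simpa using hb.sub (hslim.smul hw)
  have hstep : ∀ n, φ (p m) ≤ φ (p (τ (s n)) - s n • v (p (τ (s n)))) + ε * s n :=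
    fun n => hτ (s n) (hs0 n)
  refine ⟨t, fun t' => (hm' t').trans ?_, ?_⟩
  · refine ge_of_tendsto' (f := fun n => φ (p (τ (s n)) - s n • v (p (τ (s n)))) + ε * s n)
      (b := φ (p m)) (x := atTop) ?_ hstep
    simpa using ((hφc.tendsto _).comp ha).add (hslim.const_mul ε)
  · have hstrict : HasStrictFDerivAt φ (fderiv ℝ φ (p t)) (p t) :=
      hφ.contDiffAt.hasStrictFDerivAt one_ne_zero
    have ho := hstrict.isLittleO.comp_tendsto (ha.prodMk_nhds hb)
    have hO : (fun n => (p (τ (s n)) - s n • v (p (τ (s n)))) - p (τ (s n))) =O[atTop] s := by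
      have := (Asymptotics.isBigO_refl s atTop).smul (hw.isBigO_one ℝ)
      simpa using this.neg_left
    have hdiv := (ho.trans_isBigO hO).tendsto_div_nhds_zero
    have hL : Tendsto (fun n => fderiv ℝ φ (p t) (v (p (τ (s n))))) atTop
        (𝓝 (fderiv ℝ φ (p t) (v (p t)))) := ((fderiv ℝ φ (p t)).continuous.tendsto _).comp hw
    have hlim := hL.sub hdiv
    rw [sub_zero] at hlim
    refine le_of_tendsto' hlim fun n => ?_
    have h₁ := hstep n
    have h₂ := hm' (τ (s n))
    rw [sub_le_iff_le_add, ← sub_le_iff_le_add', le_div_iff₀ (hs0 n)]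
    simp only [Function.comp_apply, sub_sub_cancel_left, map_neg, map_smul, smul_eq_mul]
    linarith

/-- The minimax principle: if `φ` is bounded below by `α` somewhere along every member of a closed
family of maps on a compact space that is invariant under the deformations along `-v`, then there
are points with `φ ≥ α`, with `φ` bounded, at which `φ` has arbitrarily small slope along `v`. -/
theorem exists_le_and_fderiv_apply_le_of_minimax {X K : Type*} [NormedAddCommGroup X]
    [NormedSpace ℝ X] [CompleteSpace X] [PseudoMetricSpace K] [CompactSpace K] [Nonempty K]
    {φ : X → ℝ} (hφ : ContDiff ℝ 1 φ) (hφ0 : ∀ x, 0 ≤ φ x) {v : C(X, X)} {C : ℝ}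
    (hvC : ∀ x, ‖v x‖ ≤ C) {Γ : Set C(K, X)} (hΓ : IsClosed Γ)
    (hΓv : ∀ p ∈ Γ, ∀ s : ℝ, p - s • v.comp p ∈ Γ) {p₀ : C(K, X)} (hp₀ : p₀ ∈ Γ) {α : ℝ}
    (hα : ∀ p ∈ Γ, ∃ t, α ≤ φ (p t)) {ε : ℝ} (hε : 0 < ε) :
    ∃ x, α ≤ φ x ∧ (∃ t, φ x ≤ φ (p₀ t)) ∧ fderiv ℝ φ x (v x) ≤ ε * C := by
  let Φ : C(X, ℝ) := ⟨φ, hφ.continuous⟩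
  have hnorm : ∀ (p : C(K, X)) (t : K), φ (p t) ≤ ‖Φ.comp p‖ := fun p t =>
    (le_abs_self _).trans ((Φ.comp p).norm_coe_le_norm t)
  have hattain : ∀ p : C(K, X), ∃ t, ‖Φ.comp p‖ ≤ φ (p t) := by
    intro p
    obtain ⟨t, -, ht⟩ := isCompact_univ.exists_isMaxOn univ_nonempty
      (Φ.comp p).continuous.continuousOn
    refine ⟨t, (ContinuousMap.norm_le _ (hφ0 _)).2 fun t' => ?_⟩
    have : φ (p t') ≤ φ (p t) := ht (mem_univ t')
    simpa [Φ, abs_of_nonneg (hφ0 _)] using this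
  have := hΓ.completeSpace_coe
  obtain ⟨⟨p, hp⟩, hle, hmin⟩ := exists_le_forall_le_add_mul_dist
    (F := fun p : Γ => ‖Φ.comp p.1‖)
    ((Φ.continuous_postcomp.comp continuous_subtype_val).norm)
    ⟨0, by rintro _ ⟨p, rfl⟩; exact norm_nonneg _⟩ hε ⟨p₀, hp₀⟩
  obtain ⟨t, ht, hslope⟩ := exists_forall_le_and_fderiv_apply_le hφ v.continuous p.continuous
    (ε := ε * C) fun s hs t => by
      obtain ⟨t', ht'⟩ := hattain (p - s • v.comp p)
      refine ⟨t', ?_⟩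
      have hC : 0 ≤ C := (norm_nonneg _).trans (hvC (p t))
      have h₁ := hmin ⟨_, hΓv p hp s⟩
      have hd : dist (p - s • v.comp p) p ≤ s * C := by
        rw [dist_eq_norm, sub_sub_cancel_left, norm_neg,
          ContinuousMap.norm_le _ (by positivity)]
        intro t
        simpa [norm_smul, abs_of_pos hs] using mul_le_mul_of_nonneg_left (hvC (p t)) hs.le
      have h₂ := mul_le_mul_of_nonneg_left hd hε.le
      have h₃ := hnorm p t
      simp only [Subtype.dist_eq] at h₁
      have h₄ : φ (p t' - s • v (p t')) = φ ((p - s • v.comp p) t') := rfl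
      rw [h₄]
      linarith
  obtain ⟨t₁, ht₁⟩ := hα p hp
  obtain ⟨t₂, ht₂⟩ := hattain p₀
  exact ⟨p t, ht₁.trans (ht t₁), ⟨t₂, (hnorm p t).trans (hle.trans ht₂)⟩, hslope⟩

/-- On a Banach space isomorphic to a Hilbert space, a `C¹` functional admits a bounded continuous
gradient-like vector field. -/
theorem exists_bounded_gradientLike {X H : Type*} [NormedAddCommGroup X]
    [NormedSpace ℝ X] [NormedAddCommGroup H] [InnerProductSpace ℝ H] [CompleteSpace H]
    (A : X ≃L[ℝ] H) {φ : X → ℝ} (hφ : ContDiff ℝ 1 φ) :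
    ∃ (v : C(X, X)) (C : ℝ), (∀ x, ‖v x‖ ≤ C) ∧ (∀ x, fderiv ℝ φ x = 0 → v x = 0) ∧
      ∀ u : ℕ → X, (∀ n : ℕ, fderiv ℝ φ (u n) (v (u n)) ≤ 1 / ((n : ℝ) + 1) * C) →
        Tendsto (fun n => ‖fderiv ℝ φ (u n)‖) atTop (𝓝 0) := by
  have hcont : Continuous (fderiv ℝ φ) := hφ.continuous_fderiv one_ne_zero
  let B : H →L[ℝ] X := A.symm
  let g : X → H := fun x => (InnerProductSpace.toDual ℝ H).symm ((fderiv ℝ φ x).comp B)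
  have hg : Continuous g := (InnerProductSpace.toDual ℝ H).symm.continuous.comp
    (hcont.clm_comp continuous_const)
  have hpos : ∀ x, 0 < 1 + ‖g x‖ := fun x => by positivity
  let v : C(X, X) := ⟨fun x => (1 + ‖g x‖)⁻¹ • B (g x),
    ((continuous_const.add hg.norm).inv₀ fun x => (hpos x).ne').smul (B.continuous.comp hg)⟩
  have hgφ : ∀ x, fderiv ℝ φ x (B (g x)) = ‖g x‖ ^ 2 := by
    intro x
    rw [← real_inner_self_eq_norm_sq]
    exact (InnerProductSpace.toDual_symm_apply (𝕜 := ℝ) (x := g x)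
      (y := (fderiv ℝ φ x).comp B)).symm
  have hφg : ∀ x, ‖fderiv ℝ φ x‖ ≤ ‖g x‖ * ‖(A : X →L[ℝ] H)‖ := by
    intro x
    have h₁ : ‖g x‖ = ‖(fderiv ℝ φ x).comp B‖ := LinearIsometryEquiv.norm_map _ _
    have h₂ : fderiv ℝ φ x = ((fderiv ℝ φ x).comp B).comp (A : X →L[ℝ] H) := by
      ext z; simp [B]
    rw [h₁]
    conv_lhs => rw [h₂]
    exact ContinuousLinearMap.opNorm_comp_le _ _
  refine ⟨v, ‖B‖, fun x => ?_, fun x hx => ?_, fun u hu => ?_⟩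
  · change ‖(1 + ‖g x‖)⁻¹ • B (g x)‖ ≤ ‖B‖
    rw [norm_smul, norm_inv, Real.norm_of_nonneg (hpos x).le, inv_mul_le_iff₀ (hpos x)]
    nlinarith [B.le_opNorm (g x), norm_nonneg B]
  · simp [v, g, hx]
  · have hq : Tendsto (fun n : ℕ => 1 / ((n : ℝ) + 1) * ‖B‖) atTop (𝓝 0) := by
      simpa using (tendsto_one_div_add_atTop_nhds_zero_nat (𝕜 := ℝ)).mul_const ‖B‖
    have hq' : Tendsto (fun n : ℕ => (1 / ((n : ℝ) + 1) * ‖B‖) +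
        √(1 / ((n : ℝ) + 1) * ‖B‖)) atTop (𝓝 0) := by
      simpa using hq.add hq.sqrt
    have hgle : ∀ n : ℕ, ‖g (u n)‖ ≤ (1 / ((n : ℝ) + 1) * ‖B‖) + √(1 / ((n : ℝ) + 1) * ‖B‖) := by
      intro n
      have h₁ : (1 + ‖g (u n)‖)⁻¹ * ‖g (u n)‖ ^ 2 ≤ 1 / ((n : ℝ) + 1) * ‖B‖ := by
        rw [← hgφ, ← smul_eq_mul, ← map_smul]
        exact hu n
      rw [inv_mul_le_iff₀ (hpos _)] at h₁
      have hη : 0 ≤ 1 / ((n : ℝ) + 1) * ‖B‖ := by positivity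
      generalize 1 / ((n : ℝ) + 1) * ‖B‖ = η at h₁ hη
      have h₂ := Real.sq_sqrt hη
      have h₃ := Real.sqrt_nonneg η
      by_contra! hlt
      nlinarith [mul_nonneg hη h₃]
    have hg0 := squeeze_zero (fun n => norm_nonneg (g (u n))) hgle hq'
    exact squeeze_zero (fun n => norm_nonneg _) (fun n => hφg (u n))
      (by simpa using hg0.mul_const ‖(A : X →L[ℝ] H)‖)

theorem fderiv_half_norm_sub_sq_apply {X H : Type*} [NormedAddCommGroup X] [NormedSpace ℝ X]
    [NormedAddCommGroup H] [InnerProductSpace ℝ H] {f : X → H} {x : X}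
    (hf : DifferentiableAt ℝ f x) (y : H) (z : X) :
    fderiv ℝ (fun x => (1 / 2 : ℝ) * ‖f x - y‖ ^ 2) x z = inner ℝ (f x - y) (fderiv ℝ f x z) := by
  have h := ((hf.hasFDerivAt.sub_const y).norm_sq).const_mul (1 / 2 : ℝ)
  rw [h.fderiv]
  simp [inner_sub_left]

/-- A zero of the derivative of `x ↦ ‖f x - y‖² / 2` is a solution of `f x = y` when the derivative
of `f` there is onto. -/
theorem fderiv_half_norm_sub_sq_eq_zero_iff {X H : Type*} [NormedAddCommGroup X] [NormedSpace ℝ X]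
    [NormedAddCommGroup H] [InnerProductSpace ℝ H] {f : X → H} {x : X}
    (hf : DifferentiableAt ℝ f x) (hsurj : Function.Surjective (fderiv ℝ f x)) (y : H) :
    fderiv ℝ (fun x => (1 / 2 : ℝ) * ‖f x - y‖ ^ 2) x = 0 ↔ f x = y := by
  constructor
  · intro h
    obtain ⟨z, hz⟩ := hsurj (f x - y)
    have := fderiv_half_norm_sub_sq_apply hf y z
    rw [h, hz] at this
    exact sub_eq_zero.1 (inner_self_eq_zero.1 this.symm)
  · rintro rfl
    ext z
    rw [fderiv_half_norm_sub_sq_apply hf]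
    simp

/-- The minimax principle for `x ↦ ‖f x - y‖² / 2` under the Palais–Smale condition: the equation
`f x = y` is solvable and no minimax level is positive. -/
theorem exists_eq_and_le_of_minimax {X H K : Type*} [NormedAddCommGroup X] [NormedSpace ℝ X]
    [CompleteSpace X] [NormedAddCommGroup H] [InnerProductSpace ℝ H] [CompleteSpace H]
    [PseudoMetricSpace K] [CompactSpace K] [Nonempty K] {f : X → H} (hf : ContDiff ℝ 1 f) (y : H)
    (hPS : ∀ u : ℕ → X,
      (∃ M : ℝ, ∀ n : ℕ, |(1 / 2 : ℝ) * ‖f (u n) - y‖ ^ 2| ≤ M) →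
      Tendsto (fun n => ‖fderiv ℝ (fun x => (1 / 2 : ℝ) * ‖f x - y‖ ^ 2) (u n)‖) atTop (𝓝 0) →
      ∃ v : X, ∃ φ : ℕ → ℕ, StrictMono φ ∧ Tendsto (u ∘ φ) atTop (𝓝 v))
    (hinv : ∀ x : X, Function.Bijective (fderiv ℝ f x)) {Γ : Set C(K, X)} (hΓ : IsClosed Γ)
    (hΓv : ∀ v : C(X, X), (∀ x, f x = y → v x = 0) → ∀ p ∈ Γ, p - v.comp p ∈ Γ)
    (hne : Γ.Nonempty) {α : ℝ} (hα : ∀ p ∈ Γ, ∃ t, α ≤ (1 / 2 : ℝ) * ‖f (p t) - y‖ ^ 2) :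
    (∃ x, f x = y) ∧ α ≤ 0 := by
  have hd : Differentiable ℝ f := hf.differentiable one_ne_zero
  set φ : X → ℝ := fun x => (1 / 2 : ℝ) * ‖f x - y‖ ^ 2 with hφdef
  have hφ : ContDiff ℝ 1 φ := contDiff_const.mul ((hf.sub contDiff_const).norm_sq ℝ)
  have hφ0 : ∀ x, 0 ≤ φ x := fun x => by positivity
  have hcrit : ∀ x, fderiv ℝ φ x = 0 ↔ f x = y := fun x =>
    fderiv_half_norm_sub_sq_eq_zero_iff (hd x) (hinv x).surjective y
  let A : X ≃L[ℝ] H := ContinuousLinearEquiv.ofBijective (fderiv ℝ f 0)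
    (LinearMap.ker_eq_bot.2 (hinv 0).injective) (LinearMap.range_eq_top.2 (hinv 0).surjective)
  obtain ⟨v, C, hvC, hv0, hlim⟩ := exists_bounded_gradientLike A hφ
  obtain ⟨p₀, hp₀⟩ := hne
  have hseq : ∀ n : ℕ, _ := fun n =>
    exists_le_and_fderiv_apply_le_of_minimax hφ hφ0 hvC hΓ
      (fun p hp s => hΓv (s • v) (fun x hx => by simp [hv0 x ((hcrit x).2 hx)]) p hp) hp₀ hα
      (Nat.one_div_pos_of_nat (α := ℝ) (n := n))
  choose u huα hubdd hu using hseq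
  have hgrad := hlim u hu
  obtain ⟨x, ψ, hψ, hx⟩ := hPS u (by
    obtain ⟨m, -, hm⟩ := isCompact_univ.exists_isMaxOn univ_nonempty
      (hφ.continuous.comp p₀.continuous).continuousOn
    refine ⟨φ (p₀ m), fun n => ?_⟩
    obtain ⟨t, ht⟩ := hubdd n
    exact (abs_of_nonneg (hφ0 (u n))).trans_le (ht.trans (hm (mem_univ t)))) hgrad
  have hx0 : fderiv ℝ φ x = 0 := norm_eq_zero.1 <| tendsto_nhds_unique
    (((hφ.continuous_fderiv one_ne_zero).norm.tendsto x).comp hx)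
    (hgrad.comp hψ.tendsto_atTop)
  have hfx := (hcrit x).1 hx0
  have hαx : α ≤ φ x := ge_of_tendsto' ((hφ.continuous.tendsto x).comp hx) fun n => huα (ψ n)
  exact ⟨⟨x, hfx⟩, by simpa [hφdef, hfx] using hαx⟩

/-- Around a point where its derivative is a topological embedding, a map is bounded away from its
value at the point on arbitrarily small spheres. -/
theorem exists_sphere_le_norm_sub {X H : Type*} [NormedAddCommGroup X] [NormedSpace ℝ X]
    [NormedAddCommGroup H] [NormedSpace ℝ H] {f : X → H} {f' : X →L[ℝ] H} {a : X}
    (hf : HasFDerivAt f f' a) (hf' : IsInducing f') {R : ℝ} (hR : 0 < R) :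
    ∃ r ∈ Ioo 0 R, ∃ β > 0, ∀ x, dist x a = r → β ≤ ‖f x - f a‖ := by
  obtain ⟨c, hc, hO⟩ := (hf.isTheta_sub hf').isBigO_symm.exists_pos
  obtain ⟨δ, hδ, hball⟩ := Metric.eventually_nhds_iff.1 hO.bound
  refine ⟨min δ R / 2, ⟨by positivity, ?_⟩, min δ R / 2 / c, by positivity, fun x hx => ?_⟩
  · linarith [min_le_right δ R]
  · have h := hball (y := x) (by rw [hx]; linarith [min_le_left δ R, lt_min hδ hR])
    rw [← dist_eq_norm, hx] at h
    rwa [div_le_iff₀' hc]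

/-- (Theorem 3.4 of the paper, due to Idczak, Skowron and Walczak.) Let `X` be a real
Banach space and `H` a real Hilbert space. Let `f : X → H` be a `C¹`-mapping such that
for every `y ∈ H` the functional `φ(x) = (1/2)‖f(x) − y‖²` satisfies the Palais–Smale
condition, and for every `x ∈ X` the Fréchet derivative `f'(x)` is a continuous linear
bijection from `X` onto `H`. Then `f` is a diffeomorphism. -/
theorem diffeomorphism_banach_hilbert
    {X H : Type*} [NormedAddCommGroup X] [NormedSpace ℝ X] [CompleteSpace X]
    [NormedAddCommGroup H] [InnerProductSpace ℝ H] [CompleteSpace H]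
    (f : X → H)
    (hf : ContDiff ℝ 1 f)
    (hPS : ∀ y : H,
      ∀ u : ℕ → X,
        (∃ M : ℝ, ∀ n : ℕ, |(1 / 2 : ℝ) * ‖f (u n) - y‖ ^ 2| ≤ M) →
        Filter.Tendsto
          (fun n => ‖fderiv ℝ (fun x => (1 / 2 : ℝ) * ‖f x - y‖ ^ 2) (u n)‖)
          Filter.atTop (nhds 0) →
        ∃ v : X, ∃ φ : ℕ → ℕ, StrictMono φ ∧
          Filter.Tendsto (u ∘ φ) Filter.atTop (nhds v))
    (hinv : ∀ x : X, Function.Bijective (fderiv ℝ f x)) :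
    Function.Bijective f ∧
      ∃ g : H → X, Function.LeftInverse g f ∧ Function.RightInverse g f ∧
        ContDiff ℝ 1 g := by
  have hd : Differentiable ℝ f := hf.differentiable one_ne_zero
  let A : X → X ≃L[ℝ] H := fun x => ContinuousLinearEquiv.ofBijective (fderiv ℝ f x)
    (LinearMap.ker_eq_bot.2 (hinv x).injective) (LinearMap.range_eq_top.2 (hinv x).surjective)
  have hsurj : Function.Surjective f := fun y => by
    exact (exists_eq_and_le_of_minimax (K := Unit) hf y (hPS y) hinv
      isClosed_univ (fun _ _ _ _ => mem_univ _) univ_nonempty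
      (α := 0) (fun p _ => ⟨(), by positivity⟩)).1
  have hinj : Function.Injective f := by
    intro a b hab
    by_contra hne
    obtain ⟨r, ⟨hr, hrR⟩, β, hβ, hsph⟩ := exists_sphere_le_norm_sub
      (hd a).hasFDerivAt (A a).toHomeomorph.isInducing (dist_pos.2 (Ne.symm hne))
    obtain ⟨-, hle⟩ := exists_eq_and_le_of_minimax (K := unitInterval) hf (f a)
      (hPS (f a)) hinv (Γ := {p | p 0 = a ∧ p 1 = b}) (α := 1 / 2 * β ^ 2)
      ((isClosed_eq (continuous_eval_const 0) continuous_const).inter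
        (isClosed_eq (continuous_eval_const 1) continuous_const))
      (by
        rintro v hv p ⟨hp0, hp1⟩
        constructor
        · simp [hp0, hv a rfl]
        · simp [hp1, hv b hab.symm])
      ⟨⟨fun t => AffineMap.lineMap a b (t : ℝ), by
        have := AffineMap.lineMap_continuous (R := ℝ) (p := a) (q := b)
        fun_prop⟩, by simp⟩
      (by
        rintro p ⟨hp0, hp1⟩
        obtain ⟨t, ht⟩ := mem_range_of_exists_le_of_exists_ge
          (f := fun t => dist (p t) a) (c := r) (p.continuous.dist continuous_const)
          ⟨0, by simp [hp0, hr.le]⟩ ⟨1, by simpa [hp1] using hrR.le⟩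
        have := hsph (p t) ht
        exact ⟨t, by gcongr⟩)
    have : 0 < 1 / 2 * β ^ 2 := by positivity
    linarith
  have hopen : IsOpenMap f := isOpenMap_of_hasStrictFDerivAt_equiv (f' := A)
    fun x => hf.contDiffAt.hasStrictFDerivAt one_ne_zero
  let e : X ≃ₜ H := (Equiv.ofBijective f ⟨hinj, hsurj⟩).toHomeomorphOfContinuousOpen
    hf.continuous hopen
  exact ⟨⟨hinj, hsurj⟩, e.symm, e.left_inv, e.right_inv,
    e.contDiff_symm (f₀' := A) (fun x => (hd x).hasFDerivAt) hf⟩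
end

section
/- Let X be a real Banach space and let J : X → ℝ be a C¹-functional satisfying the Palais–Smale condition, for which 0 is a strict local minimum. If there exists e ≠ 0 such that J(e) ≤ J(0), then there is a critical point x̄ of J with J(x̄) > J(0) which is not a local minimum of J. -/
open Filter Topology Set Metric

/-- Ekeland's variational principle, weak form. -/
theorem LowerSemicontinuous.exists_le_add_mul_dist {α : Type*} [MetricSpace α] [CompleteSpace α]
    {f : α → ℝ} (hf : LowerSemicontinuous f) (hb : BddBelow (range f)) {ε : ℝ} (hε : 0 < ε)
    (x₀ : α) :
    ∃ v, f v + ε * dist v x₀ ≤ f x₀ ∧ ∀ z, f v ≤ f z + ε * dist z v := by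
  set S : α → Set α := fun x => {y | f y + ε * dist y x ≤ f x} with hS
  have hSself : ∀ x, x ∈ S x := fun x => by simp [hS]
  have hStrans : ∀ {x y z}, y ∈ S x → z ∈ S y → z ∈ S x := by
    intro x y z hy hz
    simp only [hS, mem_ofPred_eq] at *
    nlinarith [dist_triangle z y x]
  have hSclosed : ∀ x, IsClosed (S x) := fun x =>
    (hf.add (Continuous.lowerSemicontinuous
      (f := fun y => ε * dist y x) (by fun_prop))).isClosed_preimage (f x)
  have hex : ∀ x, ∃ y ∈ S x, ∀ z ∈ S x, 2 * f y ≤ f x + f z := by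
    intro x
    have hbS : BddBelow (f '' S x) := hb.mono (image_subset_range _ _)
    rcases (csInf_le hbS (mem_image_of_mem f (hSself x))).eq_or_lt with h | h
    · refine ⟨x, hSself x, fun z hz => ?_⟩
      have := csInf_le hbS (mem_image_of_mem f hz)
      linarith
    · obtain ⟨_, ⟨y, hy, rfl⟩, hlt⟩ := exists_lt_of_csInf_lt ⟨_, mem_image_of_mem f (hSself x)⟩
        (show sInf (f '' S x) < (f x + sInf (f '' S x)) / 2 by linarith)
      refine ⟨y, hy, fun z hz => ?_⟩
      have := csInf_le hbS (mem_image_of_mem f hz)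
      linarith
  choose g hgS hg using hex
  set u : ℕ → α := fun n => g^[n] x₀
  have hu_succ : ∀ n, u (n + 1) = g (u n) := fun n => Function.iterate_succ_apply' g n x₀
  have hmem : ∀ n m, n ≤ m → u m ∈ S (u n) := by
    intro n m hnm
    induction m, hnm using Nat.le_induction with
    | base => exact hSself _
    | succ m _ ih => exact hStrans ih (hu_succ m ▸ hgS (u m))
  have hanti : Antitone (fun n => f (u n)) := by
    intro n m hnm
    have : f (u m) + ε * dist (u m) (u n) ≤ f (u n) := hmem n m hnm
    have := mul_nonneg hε.le (dist_nonneg (x := u m) (y := u n))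
    simp only
    linarith
  have hlim : Tendsto (fun n => f (u n)) atTop (𝓝 (⨅ n, f (u n))) :=
    tendsto_atTop_ciInf hanti (hb.mono (range_comp_subset_range u f))
  set l := ⨅ n, f (u n)
  have hl : ∀ n, l ≤ f (u n) := hanti.le_of_tendsto hlim
  have hcauchy : CauchySeq u := by
    refine cauchySeq_of_le_tendsto_0' (fun n => (f (u n) - l) / ε) ?_ ?_
    · intro n m hnm
      have : f (u m) + ε * dist (u m) (u n) ≤ f (u n) := hmem n m hnm
      rw [le_div_iff₀ hε, dist_comm]
      linarith [hl m]
    · simpa using (hlim.sub_const l).div_const ε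
  obtain ⟨v, hv⟩ := cauchySeq_tendsto_of_complete hcauchy
  have hvS : ∀ n, v ∈ S (u n) := fun n =>
    (hSclosed _).mem_of_tendsto hv ((eventually_ge_atTop n).mono fun m hm => hmem n m hm)
  refine ⟨v, hvS 0, fun z => ?_⟩
  by_contra! hz
  have hzS : z ∈ S v := hz.le
  have h1 : f v ≤ l := by
    refine ge_of_tendsto' hlim fun n => ?_
    have : f v + ε * dist v (u n) ≤ f (u n) := hvS n
    have := mul_nonneg hε.le (dist_nonneg (x := v) (y := u n))
    linarith
  have h2 : 2 * l ≤ l + f z := by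
    refine le_of_tendsto_of_tendsto' ((hlim.comp (tendsto_add_atTop_nat 1)).const_mul 2)
      (hlim.add_const (f z)) fun n => ?_
    simpa only [Function.comp_apply, hu_succ] using hg (u n) z (hStrans (hvS n) hzS)
  have := mul_nonneg hε.le (dist_nonneg (x := z) (y := v))
  linarith

section MountainPass

variable {X : Type*} [NormedAddCommGroup X] [NormedSpace ℝ X]

/-- Continuous selection of directions of steep ascent along a compact family of functionals. -/
theorem exists_continuousMap_lt_apply {K : Type*} [TopologicalSpace K] [NormalSpace K]
    [ParacompactSpace K] {L : K → X →L[ℝ] ℝ} (hL : Continuous L) {M S : Set K}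
    (hM : IsClosed M) (hS : IsClosed S) (hMS : Disjoint M S) {κ : ℝ}
    (hκ : ∀ t ∈ M, κ < ‖L t‖) :
    ∃ w : C(K, X), (∀ t, ‖w t‖ ≤ 1) ∧ (∀ t ∈ S, w t = 0) ∧ ∀ t ∈ M, κ < L t (w t) := by
  have key := exists_continuous_forall_mem_convex_of_local_const
    (t := fun t => {v : X | ‖v‖ ≤ 1 ∧ (t ∈ S → v = 0) ∧ (t ∈ M → κ < L t v)}) ?_ ?_
  · obtain ⟨w, hw⟩ := key
    exact ⟨w, fun t => (hw t).1, fun t => (hw t).2.1, fun t => (hw t).2.2⟩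
  · intro t v hv v' hv' a b ha hb hab
    refine ⟨?_, fun ht => ?_, fun ht => ?_⟩
    · have := convex_closedBall (0 : X) 1 (x := v) (by simpa using hv.1) (y := v')
        (by simpa using hv'.1) ha hb hab
      simpa using this
    · simp [hv.2.1 ht, hv'.2.1 ht]
    · exact (convex_Ioi κ) (hv.2.2 ht) (hv'.2.2 ht) ha hb hab |>.trans_eq (by simp)
  · intro t
    by_cases ht : t ∈ M
    · obtain ⟨v, hv, hvL⟩ : ∃ v : X, ‖v‖ ≤ 1 ∧ κ < L t v := by
        obtain ⟨v, hv, hvL⟩ := (L t).exists_lt_apply_of_lt_opNorm (hκ t ht)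
        rcases lt_max_iff.1 (hvL.trans_eq (Real.norm_eq_abs _)) with h | h
        · exact ⟨v, hv.le, h⟩
        · exact ⟨-v, by simpa using hv.le, by simpa using h⟩
      refine ⟨v, ?_⟩
      have h1 : ∀ᶠ y in 𝓝 t, κ < L y v :=
        (hL.clm_apply continuous_const).continuousAt.eventually_const_lt hvL
      have h2 : ∀ᶠ y in 𝓝 t, y ∉ S :=
        hS.isOpen_compl.eventually_mem (disjoint_left.1 hMS ht)
      filter_upwards [h1, h2] with y hy hyS
      exact ⟨hv, fun h => absurd h hyS, fun _ => hy⟩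
    · refine ⟨0, ?_⟩
      filter_upwards [hM.isOpen_compl.eventually_mem ht] with y hy
      exact ⟨by simp, fun _ => rfl, fun h => absurd h hy⟩

/-- If `γ` almost minimizes `γ' ↦ max (J + ψ) ∘ γ'` among maps agreeing with `γ` on `S`, up to an
error `δ * dist γ γ'`, then the derivative of `J` is small somewhere on the set where
`(J + ψ) ∘ γ` is maximal. -/
theorem exists_isMaxOn_norm_fderiv_le {K : Type*} [MetricSpace K]
    [CompactSpace K] {J ψ : X → ℝ} (hJ : ContDiff ℝ 1 J)
    {C : NNReal} (hψ : LipschitzWith C ψ) {δ : ℝ} (γ : C(K, X)) {S : Set K} (hS : IsClosed S)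
    (hmin : ∀ γ' : C(K, X), (∀ t ∈ S, γ' t = γ t) →
      ∃ t, ∀ s, J (γ s) + ψ (γ s) ≤ J (γ' t) + ψ (γ' t) + δ * dist γ' γ)
    (hSlt : ∀ t ∈ S, ∃ s, J (γ t) + ψ (γ t) < J (γ s) + ψ (γ s)) (hδ : 0 ≤ δ) :
    ∃ t, (∀ s, J (γ s) + ψ (γ s) ≤ J (γ t) + ψ (γ t)) ∧ ‖fderiv ℝ J (γ t)‖ ≤ C + δ := by
  by_contra! hcon
  have hJc := hJ.continuous
  have hψc := hψ.continuous
  set M : Set K := {t | ∀ s, J (γ s) + ψ (γ s) ≤ J (γ t) + ψ (γ t)} with hMdef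
  have hM : IsClosed M := by
    simp only [hMdef, ofPred_forall]
    exact isClosed_iInter fun s => isClosed_le continuous_const (by fun_prop)
  have hMS : Disjoint M S := by
    rw [disjoint_left]
    intro t ht htS
    obtain ⟨s, hs⟩ := hSlt t htS
    exact (ht s).not_gt hs
  obtain ⟨w, hw1, hwS, hwM⟩ := exists_continuousMap_lt_apply
    (L := fun t => fderiv ℝ J (γ t)) ((hJ.continuous_fderiv one_ne_zero).comp γ.continuous)
    hM hS hMS hcon
  obtain ⟨r, -, hr0, hr⟩ := exists_seq_strictAnti_tendsto (0 : ℝ)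
  have hdist : ∀ n, dist (γ - r n • w) γ ≤ r n := fun n => by
    rw [ContinuousMap.dist_le (hr0 n).le]
    intro t
    rw [dist_eq_norm]
    simpa [norm_smul, abs_of_pos (hr0 n)] using
      mul_le_of_le_one_right (hr0 n).le (hw1 t)
  have hstep : ∀ n, ∃ t, ∀ s, J (γ s) + ψ (γ s) ≤
      J (γ t - r n • w t) + ψ (γ t - r n • w t) + δ * r n := fun n => by
    obtain ⟨t, ht⟩ := hmin (γ - r n • w) fun t ht => by simp [hwS t ht]
    exact ⟨t, fun s => (ht s).trans <| by
      simpa using mul_le_mul_of_nonneg_left (hdist n) hδ⟩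
  choose t ht using hstep
  obtain ⟨τ, φ, hφ, hτ⟩ := CompactSpace.tendsto_subseq t
  have hrφ : Tendsto (fun n => r (φ n)) atTop (𝓝 0) := hr.comp hφ.tendsto_atTop
  have hγτ : Tendsto (fun n => γ (t (φ n))) atTop (𝓝 (γ τ)) :=
    (γ.continuous.tendsto τ).comp hτ
  have hwτ : Tendsto (fun n => w (t (φ n))) atTop (𝓝 (w τ)) :=
    (w.continuous.tendsto τ).comp hτ
  have hγwτ : Tendsto (fun n => γ (t (φ n)) - r (φ n) • w (t (φ n))) atTop (𝓝 (γ τ)) := by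
    simpa using hγτ.sub (hrφ.smul hwτ)
  have hτM : τ ∈ M := fun s => by
    have h := (((hJc.tendsto _).comp hγwτ).add ((hψc.tendsto _).comp hγwτ)).add
      (hrφ.const_mul δ)
    simp only [mul_zero, add_zero] at h
    exact ge_of_tendsto' h fun n => ht (φ n) s
  have hlt := hwM τ hτM
  have hstrict := (hJ.contDiffAt (x := γ τ)).hasStrictFDerivAt one_ne_zero
  obtain ⟨η, hη0, hη⟩ : ∃ η > 0, C + δ + η < fderiv ℝ J (γ τ) (w τ) :=
    ⟨(fderiv ℝ J (γ τ) (w τ) - (C + δ)) / 2, by linarith, by linarith⟩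
  have hbound := (hγwτ.prodMk_nhds hγτ).eventually
    (Asymptotics.isLittleO_iff.1 (hasStrictFDerivAt_iff_isLittleO.1 hstrict) hη0)
  have hev : ∀ᶠ n in atTop, C + δ + η < fderiv ℝ J (γ τ) (w (t (φ n))) :=
    (((fderiv ℝ J (γ τ)).continuous.tendsto _).comp hwτ).eventually_const_lt hη
  obtain ⟨n, hn1, hn2⟩ := (hbound.and hev).exists
  set x := γ (t (φ n))
  set v := w (t (φ n))
  have hpos := hr0 (φ n)
  set ρ := r (φ n)
  have hv1 : ρ * ‖v‖ ≤ ρ := mul_le_of_le_one_right hpos.le (hw1 _)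
  have hψ1 : ψ (x - ρ • v) - ψ x ≤ C * ρ := by
    have h := hψ.dist_le_mul (x - ρ • v) x
    rw [Real.dist_eq, dist_eq_norm] at h
    have h' : ‖x - ρ • v - x‖ ≤ ρ := by simpa [norm_smul, abs_of_pos hpos] using hv1
    exact (le_abs_self _).trans (h.trans (mul_le_mul_of_nonneg_left h' C.2))
  have h3 := ht (φ n) (t (φ n))
  have h4 : η * ‖x - ρ • v - x‖ ≤ η * ρ := by
    refine mul_le_mul_of_nonneg_left ?_ hη0.le
    simpa [norm_smul, abs_of_pos hpos] using hv1
  have h5 := (le_abs_self _).trans (hn1.trans h4)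
  have h6 : fderiv ℝ J (γ τ) (x - ρ • v - x) = - (ρ * fderiv ℝ J (γ τ) v) := by simp
  simp only [h6] at h5
  change J x + ψ x ≤ J (x - ρ • v) + ψ (x - ρ • v) + δ * ρ at h3
  nlinarith [mul_lt_mul_of_pos_left hn2 hpos]

/-- Quantitative mountain pass with localization near a separating set `F`. -/
theorem exists_almost_critical_near_of_small [CompleteSpace X] {J : X → ℝ}
    (hJ : ContDiff ℝ 1 J)
    {a b : X} {F : Set X} (hF : ∀ γ : Path a b, ∃ t, γ t ∈ F) {c : ℝ} (hc : ∀ x ∈ F, c ≤ J x)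
    {ε : ℝ} (hε : 0 < ε) (ha : ε ≤ infDist a F) (hb : ε ≤ infDist b F)
    (hpath : ∃ γ : Path a b, ∀ t, J (γ t) ≤ c + ε ^ 2 / 4) :
    ∃ x, infDist x F ≤ 2 * ε ∧ c ≤ J x ∧ J x ≤ c + 2 * ε ^ 2 ∧ ‖fderiv ℝ J x‖ ≤ 2 * ε := by
  obtain ⟨γ₀, hγ₀⟩ := hpath
  have hJc := hJ.continuous
  set ψ : X → ℝ := fun x => max 0 (ε ^ 2 - ε * infDist x F) with hψdef
  have hψ0 : ∀ x, 0 ≤ ψ x := fun x => le_max_left _ _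
  have hψle : ∀ x, ψ x ≤ ε ^ 2 := fun x =>
    max_le (sq_nonneg ε) (by nlinarith [infDist_nonneg (x := x) (s := F)])
  have hψF : ∀ x ∈ F, ψ x = ε ^ 2 := fun x hx => by
    simp [hψdef, infDist_zero_of_mem hx, sq_nonneg]
  have hψfar : ∀ x, ε ≤ infDist x F → ψ x = 0 := fun x hx =>
    max_eq_left (by nlinarith)
  have hψ : LipschitzWith ⟨ε, hε.le⟩ ψ := by
    refine LipschitzWith.of_le_add_mul _ fun x y => ?_
    have h := infDist_le_infDist_add_dist (s := F) (x := y) (y := x)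
    rw [dist_comm] at h
    change ψ x ≤ ψ y + ε * dist x y
    refine max_le (add_nonneg (hψ0 y) (by positivity)) ?_
    have h2 : ε ^ 2 - ε * infDist y F ≤ ψ y := le_max_right _ _
    nlinarith
  have hψc := hψ.continuous
  set S : Set unitInterval := {t | ε ≤ infDist (γ₀ t) F} with hSdef
  have hS : IsClosed S := isClosed_le continuous_const
    ((continuous_infDist_pt F).comp γ₀.continuous)
  have hJS : ∀ t ∈ S, J (γ₀ t) + ψ (γ₀ t) < c + ε ^ 2 := fun t ht => by
    rw [hψfar _ ht]
    nlinarith [hγ₀ t, pow_pos hε 2]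
  have h0S : (0 : unitInterval) ∈ S := by simpa [hSdef] using ha
  have h1S : (1 : unitInterval) ∈ S := by simpa [hSdef] using hb
  set Γ : Set C(unitInterval, X) := {γ | ∀ t ∈ S, γ t = γ₀ t} with hΓdef
  have hΓ : IsClosed Γ := by
    have : Γ = ⋂ t ∈ S, {γ : C(unitInterval, X) | γ t = γ₀ t} := by ext; simp [hΓdef]
    rw [this]
    exact isClosed_biInter fun t _ =>
      isClosed_eq (continuous_eval_const t) continuous_const
  have : CompleteSpace Γ := hΓ.completeSpace_coe
  have hcross : ∀ γ ∈ Γ, ∃ t, c + ε ^ 2 ≤ J (γ t) + ψ (γ t) := by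
    intro γ hγ
    obtain ⟨t, ht⟩ := hF ⟨γ, by simpa using hγ 0 h0S, by simpa using hγ 1 h1S⟩
    change γ t ∈ F at ht
    exact ⟨t, by linarith [hψF _ ht, hc _ ht]⟩
  set Φ : Γ → ℝ := fun γ => sSup ((fun t => J (γ.1 t) + ψ (γ.1 t)) '' univ)
  have hΦcont : Continuous Φ := by
    refine isCompact_univ.continuous_sSup
      (f := fun (γ : Γ) (t : unitInterval) => J (γ.1 t) + ψ (γ.1 t)) ?_
    change Continuous fun p : Γ × unitInterval => J (p.1.1 p.2) + ψ (p.1.1 p.2)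
    fun_prop
  have hle : ∀ (γ : Γ) t, J (γ.1 t) + ψ (γ.1 t) ≤ Φ γ := fun γ t =>
    le_csSup (isCompact_univ.bddAbove_image (by fun_prop)) (mem_image_of_mem _ (mem_univ t))
  have hmax : ∀ γ : Γ, ∃ t, Φ γ = J (γ.1 t) + ψ (γ.1 t) := fun γ => by
    obtain ⟨t, -, ht⟩ := isCompact_univ.exists_sSup_image_eq univ_nonempty
      (f := fun t => J (γ.1 t) + ψ (γ.1 t)) (by fun_prop)
    exact ⟨t, ht⟩
  have hΦge : ∀ γ : Γ, c + ε ^ 2 ≤ Φ γ := fun γ => by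
    obtain ⟨t, ht⟩ := hcross γ.1 γ.2
    exact ht.trans (hle γ t)
  obtain ⟨γ, hγ₀γ, hγ⟩ := hΦcont.lowerSemicontinuous.exists_le_add_mul_dist
    ⟨c + ε ^ 2, forall_mem_range.2 hΦge⟩ (half_pos hε)
    ⟨γ₀.toContinuousMap, fun t _ => rfl⟩
  have hΦ₀ : Φ ⟨γ₀.toContinuousMap, fun t _ => rfl⟩ ≤ c + ε ^ 2 / 4 + ε ^ 2 := by
    obtain ⟨t, ht⟩ := hmax ⟨γ₀.toContinuousMap, fun t _ => rfl⟩
    rw [ht]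
    exact add_le_add (hγ₀ t) (hψle _)
  have hd : dist γ.1 γ₀.toContinuousMap ≤ ε := by
    have h := hΦge γ
    change Φ γ + ε / 2 * dist γ.1 γ₀.toContinuousMap ≤ _ at hγ₀γ
    nlinarith
  have hΦγ : Φ γ ≤ c + 2 * ε ^ 2 := by
    have := mul_nonneg (half_pos hε).le
      (dist_nonneg (x := γ) (y := ⟨γ₀.toContinuousMap, fun t _ => rfl⟩))
    nlinarith
  obtain ⟨t, ht, htJ⟩ := exists_isMaxOn_norm_fderiv_le hJ hψ γ.1 hS (δ := ε / 2)
    (fun γ' hγ' => by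
      have hγ'Γ : γ' ∈ Γ := fun t ht => (hγ' t ht).trans (γ.2 t ht)
      obtain ⟨t, ht⟩ := hmax ⟨γ', hγ'Γ⟩
      exact ⟨t, fun s => (hle γ s).trans ((hγ ⟨γ', hγ'Γ⟩).trans_eq (by rw [ht]; rfl))⟩)
    (fun t htS => by
      obtain ⟨s, hs⟩ := hcross γ.1 γ.2
      exact ⟨s, by rw [γ.2 t htS]; exact (hJS t htS).trans_le hs⟩)
    (half_pos hε).le
  obtain ⟨s, hs⟩ := hcross γ.1 γ.2
  have hGt := hs.trans (ht s)
  refine ⟨γ.1 t, ?_, by linarith [hψle (γ.1 t)], by linarith [hle γ t, hψ0 (γ.1 t)], ?_⟩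
  · have htS : t ∉ S := fun htS => by
      have := hJS t htS
      rw [← γ.2 t htS] at this
      linarith
    have h1 : infDist (γ₀ t) F < ε := not_le.1 htS
    have h2 := infDist_le_infDist_add_dist (s := F) (x := γ.1 t) (y := γ₀ t)
    have h3 : dist (γ.1 t) (γ₀ t) ≤ dist γ.1 γ₀.toContinuousMap :=
      ContinuousMap.dist_apply_le_dist t
    linarith
  · change _ ≤ ε + ε / 2 at htJ
    linarith

/-- Mountain pass theorem with the critical point located on the boundary of a set separating
the endpoints. -/
theorem exists_critical_mem_frontier [CompleteSpace X] {J : X → ℝ} (hJ : ContDiff ℝ 1 J)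
    (hPS : ∀ u : ℕ → X, (∃ M : ℝ, ∀ n : ℕ, |J (u n)| ≤ M) →
      Tendsto (fun n => ‖fderiv ℝ J (u n)‖) atTop (𝓝 0) →
      ∃ v : X, ∃ φ : ℕ → ℕ, StrictMono φ ∧ Tendsto (u ∘ φ) atTop (𝓝 v))
    {a b : X} {A : Set X} (ha : a ∈ A) (hb : b ∉ A) (haF : a ∉ frontier A)
    (hbF : b ∉ frontier A) {c : ℝ} (hc : ∀ x ∈ frontier A, c ≤ J x)
    (hpath : ∀ ε > 0, ∃ γ : Path a b, ∀ t, J (γ t) ≤ c + ε) :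
    ∃ x ∈ frontier A, J x = c ∧ fderiv ℝ J x = 0 := by
  have hF : ∀ γ : Path a b, ∃ t, γ t ∈ frontier A := by
    intro γ
    have hne : (frontier (γ ⁻¹' A)).Nonempty := by
      refine nonempty_frontier_iff.2 ⟨⟨0, by simpa using ha⟩, fun h => hb ?_⟩
      have : (1 : unitInterval) ∈ γ ⁻¹' A := h ▸ mem_univ _
      simpa using this
    obtain ⟨t, ht⟩ := hne
    exact ⟨t, γ.continuous.frontier_preimage_subset A ht⟩
  have hFne : (frontier A).Nonempty := by
    obtain ⟨γ, -⟩ := hpath 1 one_pos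
    obtain ⟨t, ht⟩ := hF γ
    exact ⟨_, ht⟩
  have hpa := (isClosed_frontier.notMem_iff_infDist_pos hFne).1 haF
  have hpb := (isClosed_frontier.notMem_iff_infDist_pos hFne).1 hbF
  obtain ⟨ε, -, hε, hε0⟩ := exists_seq_strictAnti_tendsto' (lt_min hpa hpb)
  have hex : ∀ n, ∃ x, infDist x (frontier A) ≤ 2 * ε n ∧ c ≤ J x ∧ J x ≤ c + 2 * ε n ^ 2 ∧
      ‖fderiv ℝ J x‖ ≤ 2 * ε n := fun n =>
    exists_almost_critical_near_of_small hJ hF hc (hε n).1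
      ((hε n).2.le.trans (min_le_left _ _)) ((hε n).2.le.trans (min_le_right _ _))
      (hpath _ (by have := (hε n).1; positivity))
  choose u hu1 hu2 hu3 hu4 using hex
  have h2ε : Tendsto (fun n => 2 * ε n) atTop (𝓝 0) := by simpa using hε0.const_mul 2
  have hJu : Tendsto (fun n => J (u n)) atTop (𝓝 c) := by
    refine tendsto_of_tendsto_of_tendsto_of_le_of_le tendsto_const_nhds ?_ hu2 hu3
    simpa using ((hε0.pow 2).const_mul 2).const_add c
  have hdu : Tendsto (fun n => ‖fderiv ℝ J (u n)‖) atTop (𝓝 0) :=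
    squeeze_zero (fun n => norm_nonneg _) hu4 h2ε
  have hFu : Tendsto (fun n => infDist (u n) (frontier A)) atTop (𝓝 0) :=
    squeeze_zero (fun n => infDist_nonneg) hu1 h2ε
  obtain ⟨M, hM⟩ := hJu.abs.bddAbove_range
  obtain ⟨v, φ, hφ, hv⟩ := hPS u ⟨M, fun n => hM ⟨n, rfl⟩⟩ hdu
  have hφ := hφ.tendsto_atTop
  refine ⟨v, ?_, ?_, ?_⟩
  · rw [isClosed_frontier.mem_iff_infDist_zero hFne]
    exact tendsto_nhds_unique (((continuous_infDist_pt _).tendsto v).comp hv) (hFu.comp hφ)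
  · exact tendsto_nhds_unique ((hJ.continuous.tendsto v).comp hv) (hJu.comp hφ)
  · exact norm_eq_zero.1 (tendsto_nhds_unique
      (((hJ.continuous_fderiv one_ne_zero).norm.tendsto v).comp hv) (hdu.comp hφ))

end MountainPass

/-- The boundary of a path component of an open sublevel set lies in the level set. -/
theorem eq_of_mem_frontier_pathComponentIn_lt {Y : Type*} [TopologicalSpace Y]
    [LocallyPathConnectedSpace Y] {J : Y → ℝ} (hJ : Continuous J) {c : ℝ} {a x : Y}
    (hx : x ∈ frontier (pathComponentIn {y | J y < c} a)) : J x = c := by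
  have hopen : IsOpen {y | J y < c} := isOpen_lt hJ continuous_const
  have hA : IsOpen (pathComponentIn {y | J y < c} a) := hopen.pathComponentIn a
  refine le_antisymm ?_ ?_
  · exact closure_minimal (fun y hy => show J y ≤ c from
        le_of_lt (show y ∈ {y | J y < c} from pathComponentIn_subset hy))
      (isClosed_le hJ continuous_const) hx.1
  · by_contra! hlt
    obtain ⟨y, hyx, hya⟩ := mem_closure_iff.1 hx.1 _ (hopen.pathComponentIn x)
      (mem_pathComponentIn_self hlt)
    rw [hA.frontier_eq] at hx
    exact hx.2 (JoinedIn.trans hya hyx.symm)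



/-- **Three critical points theorem of Pucci and Serrin** (Theorem 3.5 of the paper).
Let `X` be a real Banach space and `J : X → ℝ` a `C¹`-functional satisfying the
Palais–Smale condition, for which `0` is a strict local minimum. If there exists
`e ≠ 0` with `J(e) ≤ J(0)`, then there is a critical point `xbar` of `J` with
`J(xbar) > J(0)` which is not a local minimum of `J`. -/
theorem pucci_serrin_three_critical_points
    {X : Type*} [NormedAddCommGroup X] [NormedSpace ℝ X] [CompleteSpace X]
    (J : X → ℝ)
    (hJ : ContDiff ℝ 1 J)
    (hPS : ∀ u : ℕ → X, (∃ M : ℝ, ∀ n : ℕ, |J (u n)| ≤ M) →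
      Filter.Tendsto (fun n => ‖fderiv ℝ J (u n)‖) Filter.atTop (nhds 0) →
      ∃ v : X, ∃ φ : ℕ → ℕ, StrictMono φ ∧
        Filter.Tendsto (u ∘ φ) Filter.atTop (nhds v))
    (hmin : ∃ U ∈ nhds (0 : X), ∀ x ∈ U, x ≠ 0 → J 0 < J x)
    (e : X) (he : e ≠ 0) (hJe : J e ≤ J 0) :
    ∃ xbar : X, fderiv ℝ J xbar = 0 ∧ J 0 < J xbar ∧
      ¬ (∃ U ∈ nhds xbar, ∀ x ∈ U, J xbar ≤ J x) := by
  have hJc := hJ.continuous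
  have hmaxpath : ∀ γ : Path (0 : X) e, ∃ s, ∀ t, J (γ t) ≤ J (γ s) := fun γ => by
    obtain ⟨s, -, hs⟩ := isCompact_univ.exists_isMaxOn univ_nonempty
      (hJc.comp γ.continuous).continuousOn
    exact ⟨s, fun t => hs (mem_univ t)⟩
  set B : Set ℝ := {m | ∃ γ : Path (0 : X) e, ∀ t, J (γ t) ≤ m}
  have hBbdd : J 0 ∈ lowerBounds B := fun m ⟨γ, hγ⟩ => by simpa using hγ 0
  have hBne : B.Nonempty := by
    obtain ⟨s, hs⟩ := hmaxpath (PathConnectedSpace.joined 0 e).somePath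
    exact ⟨_, _, hs⟩
  set c := sInf B
  have hpath : ∀ ε > 0, ∃ γ : Path (0 : X) e, ∀ t, J (γ t) ≤ c + ε := fun ε hε => by
    obtain ⟨m, ⟨γ, hγ⟩, hm⟩ := exists_lt_of_csInf_lt hBne (lt_add_of_pos_right c hε)
    exact ⟨γ, fun t => (hγ t).trans hm.le⟩
  have hc : J 0 < c := by
    refine lt_of_le_of_ne (le_csInf hBne hBbdd) fun hc => ?_
    obtain ⟨U, hU, hUJ⟩ := hmin
    obtain ⟨R, hR, hRU⟩ := nhds_basis_closedBall.mem_iff.1 hU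
    obtain ⟨r, hr0, hr⟩ := exists_between (lt_min hR (norm_pos_iff.2 he))
    obtain ⟨hrR, hre⟩ := lt_min_iff.1 hr
    have hsphere : frontier (ball (0 : X) r) = sphere 0 r := frontier_ball _ hr0.ne'
    have hpos : ∀ x ∈ frontier (ball (0 : X) r), J 0 < J x := fun x hx => by
      rw [hsphere] at hx
      exact hUJ x (hRU (closedBall_subset_closedBall hrR.le (sphere_subset_closedBall hx)))
        (ne_of_mem_sphere hx hr0.ne')
    obtain ⟨x, hx, hJx, -⟩ := exists_critical_mem_frontier hJ hPS (mem_ball_self hr0)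
      (b := e) (by simpa using hre.le) (by simpa [hsphere] using hr0.ne)
      (by simpa [hsphere] using hre.ne') (fun x hx => hc ▸ (hpos x hx).le) hpath
    exact (hpos x hx).ne (hc.trans hJx.symm)
  set A := pathComponentIn {y | J y < c} 0
  have hfr : ∀ x ∈ frontier A, J x = c := fun x hx =>
    eq_of_mem_frontier_pathComponentIn_lt hJc hx
  have heA : e ∉ A := fun h => by
    obtain ⟨γ, hγ⟩ : JoinedIn {y | J y < c} 0 e := h
    obtain ⟨s, hs⟩ := hmaxpath γ
    have h1 : c ≤ J (γ s) := csInf_le ⟨_, hBbdd⟩ ⟨γ, hs⟩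
    exact (hγ s).not_ge h1
  obtain ⟨x, hx, hJx, hdx⟩ := exists_critical_mem_frontier hJ hPS
    (mem_pathComponentIn_self hc) heA (fun h => hc.ne (hfr 0 h))
    (fun h => (hJe.trans_lt hc).ne (hfr e h)) (fun x hx => (hfr x hx).ge) hpath
  refine ⟨x, hdx, hJx ▸ hc, fun ⟨U, hU, hUJ⟩ => ?_⟩
  obtain ⟨y, hyU, hyA⟩ := mem_closure_iff_nhds.1 hx.1 U hU
  have hy : y ∈ {y | J y < c} := pathComponentIn_subset hyA
  exact (hUJ y hyU).not_gt (hy.trans_eq hJx.symm)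
end

section
/- Let X and Y be real Banach spaces, let f : X → Y be a C¹-mapping, and let η : Y → [0, ∞) be a C¹-functional such that: (A1) η(x) = 0 if and only if x = 0, and η'(x) = 0 if and only if x = 0; (A2) for every y ∈ Y the functional φ : X → ℝ given by φ(x) = η(f(x) − y) satisfies the Palais–Smale condition; (A3) for every x ∈ X the Fréchet derivative f'(x) is a continuous linear bijection from X onto Y. Then f is a diffeomorphism. -/
open Filter Topology in
/-- **Ekeland's variational principle** for a nonnegative lower semicontinuous function on a
complete metric space. -/
theorem LowerSemicontinuous.exists_ekeland_s9 {E : Type*} [MetricSpace E] [CompleteSpace E]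
    {φ : E → ℝ} (hφ : LowerSemicontinuous φ) (hpos : ∀ x, 0 ≤ φ x) {c : ℝ} (hc : 0 < c) (x : E) :
    ∃ z, φ z + c * dist x z ≤ φ x ∧ ∀ w, φ z ≤ φ w + c * dist z w := by
  let S : E → Set E := fun x => {w | φ w + c * dist x w ≤ φ x}
  have S_self (x : E) : x ∈ S x := by simp [S]
  have S_closed (x : E) : IsClosed (S x) :=
    (hφ.add (by fun_prop : Continuous fun w => c * dist x w).lowerSemicontinuous).isClosed_preimage
      (φ x)
  have S_trans {x y w : E} (hy : y ∈ S x) (hw : w ∈ S y) : w ∈ S x := by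
    simp only [S, Set.mem_ofPred_eq] at *
    nlinarith [dist_triangle x y w]
  have step (x : E) (ε : ℝ) (hε : 0 < ε) : ∃ y ∈ S x, ∀ w ∈ S x, φ y ≤ φ w + ε := by
    have hbdd : BddBelow (φ '' S x) := ⟨0, by rintro _ ⟨w, -, rfl⟩; exact hpos w⟩
    obtain ⟨_, ⟨y, hy, rfl⟩, hlt⟩ := exists_lt_of_csInf_lt (Set.Nonempty.image φ ⟨x, S_self x⟩)
      (lt_add_of_pos_right (sInf (φ '' S x)) hε)
    exact ⟨y, hy, fun w hw => hlt.le.trans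
      (by gcongr; exact csInf_le hbdd (Set.mem_image_of_mem φ hw))⟩
  choose g g_mem g_le using step
  let u : ℕ → E := fun n => Nat.rec x (fun n y => g y (1 / (n + 1)) Nat.one_div_pos_of_nat) n
  have u_mem {n m : ℕ} (h : n ≤ m) : u m ∈ S (u n) := by
    induction m, h using Nat.le_induction with
    | base => exact S_self _
    | succ m _ ih => exact S_trans ih (g_mem _ _ _)
  have u_anti : Antitone (φ ∘ u) := fun n m h => by
    have : φ (u m) + c * dist (u n) (u m) ≤ φ (u n) := u_mem h
    have := mul_nonneg hc.le (dist_nonneg (x := u n) (y := u m))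
    simp only [Function.comp_apply]
    linarith
  have u_lim := tendsto_atTop_ciInf u_anti ⟨0, by rintro _ ⟨n, rfl⟩; exact hpos _⟩
  set l := ⨅ n, (φ ∘ u) n
  have u_cauchy : CauchySeq u := by
    refine cauchySeq_of_le_tendsto_0' (fun n => (φ (u n) - l) / c) (fun n m h => ?_) ?_
    · have : φ (u m) + c * dist (u n) (u m) ≤ φ (u n) := u_mem h
      have := u_anti.le_of_tendsto u_lim m
      simp only [Function.comp_apply] at this
      rw [le_div_iff₀ hc]
      linarith
    · simpa using (u_lim.sub_const l).div_const c
  obtain ⟨z, hz⟩ := cauchySeq_tendsto_of_complete u_cauchy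
  have z_mem (n : ℕ) : z ∈ S (u n) :=
    (S_closed _).mem_of_tendsto hz (eventually_atTop.2 ⟨n, fun m h => u_mem h⟩)
  refine ⟨z, z_mem 0, fun w => ?_⟩
  by_contra! hw
  have w_le (n : ℕ) : φ z ≤ φ w + 1 / ((n : ℝ) + 1) := by
    have h₁ : φ z + c * dist (u (n + 1)) z ≤ φ (u (n + 1)) := z_mem (n + 1)
    have h₂ := mul_nonneg hc.le (dist_nonneg (x := u (n + 1)) (y := z))
    have h₃ : φ (u (n + 1)) ≤ φ w + 1 / ((n : ℝ) + 1) :=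
      g_le _ _ _ w (S_trans (z_mem n) (by exact hw.le))
    linarith
  have : φ z ≤ φ w := ge_of_tendsto' (by
    simpa using (tendsto_one_div_add_atTop_nhds_zero_nat (𝕜 := ℝ)).const_add (φ w)) w_le
  have := mul_nonneg hc.le (dist_nonneg (x := z) (y := w))
  linarith

open Filter Topology in
theorem HasFDerivAt.norm_le_of_forall_le_add_s9 {E : Type*} [NormedAddCommGroup E]
    [NormedSpace ℝ E] {φ : E → ℝ} {L : E →L[ℝ] ℝ} {z : E} {c : ℝ} (hφ : HasFDerivAt φ L z)
    (hc : 0 ≤ c) (h : ∀ w, φ z ≤ φ w + c * dist z w) : ‖L‖ ≤ c := by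
  have key (v : E) : -(c * ‖v‖) ≤ L v := by
    refine ge_of_tendsto (hφ.hasLineDerivAt v).tendsto_slope_zero_right ?_
    filter_upwards [self_mem_nhdsWithin] with t (ht : 0 < t)
    have := h (z + t • v)
    rw [dist_self_add_right, norm_smul, Real.norm_of_nonneg ht.le] at this
    rw [smul_eq_mul, inv_mul_eq_div, le_div_iff₀ ht]
    linarith
  refine L.opNorm_le_bound hc fun v => abs_le.2 ⟨key v, ?_⟩
  have := key (-v)
  rw [norm_neg, map_neg] at this
  linarith

open Filter Topology in
/-- A sequence along which a nonnegative functional satisfying the Palais–Smale condition tends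
to zero has a convergent subsequence. -/
theorem exists_tendsto_subseq_of_palaisSmale {E : Type*} [NormedAddCommGroup E]
    [NormedSpace ℝ E] [CompleteSpace E] {J : E → ℝ} (hJ : Differentiable ℝ J)
    (hpos : ∀ x, 0 ≤ J x)
    (hPS : ∀ u : ℕ → E, (∃ M : ℝ, ∀ n, |J (u n)| ≤ M) →
      Tendsto (fun n => ‖fderiv ℝ J (u n)‖) atTop (𝓝 0) →
      ∃ v : E, ∃ φ : ℕ → ℕ, StrictMono φ ∧ Tendsto (u ∘ φ) atTop (𝓝 v))
    {x : ℕ → E} (hx : Tendsto (fun n => J (x n)) atTop (𝓝 0)) :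
    ∃ v : E, ∃ φ : ℕ → ℕ, StrictMono φ ∧ Tendsto (x ∘ φ) atTop (𝓝 v) := by
  let c : ℕ → ℝ := fun n => √(J (x n)) + 1 / ((n : ℝ) + 1)
  have c_pos (n : ℕ) : 0 < c n :=
    add_pos_of_nonneg_of_pos (Real.sqrt_nonneg _) Nat.one_div_pos_of_nat
  have sqrt_lim : Tendsto (fun n => √(J (x n))) atTop (𝓝 0) := by simpa using hx.sqrt
  have c_lim : Tendsto c atTop (𝓝 0) := by
    simpa [c] using sqrt_lim.add (tendsto_one_div_add_atTop_nhds_zero_nat (𝕜 := ℝ))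
  choose z hz hmin using fun n =>
    hJ.continuous.lowerSemicontinuous.exists_ekeland_s9 hpos (c_pos n) (x n)
  have z_le (n : ℕ) : J (z n) ≤ J (x n) := by
    have := hz n
    have := mul_nonneg (c_pos n).le (dist_nonneg (x := x n) (y := z n))
    linarith
  have z_dist (n : ℕ) : dist (x n) (z n) ≤ √(J (x n)) := by
    refine le_of_mul_le_mul_left ?_ (c_pos n)
    calc c n * dist (x n) (z n) ≤ J (x n) := by linarith [hz n, hpos (z n)]
      _ = √(J (x n)) * √(J (x n)) := (Real.mul_self_sqrt (hpos _)).symm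
      _ ≤ c n * √(J (x n)) := by
        gcongr
        exact le_add_of_nonneg_right Nat.one_div_pos_of_nat.le
  obtain ⟨M, hM⟩ := hx.bddAbove_range
  obtain ⟨v, φ, hφ, hv⟩ := hPS z
    ⟨M, fun n => by
      rw [abs_of_nonneg (hpos _)]
      exact (z_le n).trans (hM (Set.mem_range_self n))⟩
    (squeeze_zero (fun _ => norm_nonneg _)
      (fun n => (hJ (z n)).hasFDerivAt.norm_le_of_forall_le_add_s9 (c_pos n).le (hmin n)) c_lim)
  have dist_lim : Tendsto (fun n => dist (z n) (x n)) atTop (𝓝 0) :=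
    squeeze_zero (fun _ => dist_nonneg) (fun n => by rw [dist_comm]; exact z_dist n) sqrt_lim
  exact ⟨v, φ, hφ, hv.congr_dist (dist_lim.comp hφ.tendsto_atTop)⟩

/-- A proper local homeomorphism from a nonempty connected Hausdorff space to a simply connected,
locally path-connected space is bijective. -/
theorem IsLocalHomeomorph.bijective_of_isProperMap {E B : Type*} [TopologicalSpace E]
    [TopologicalSpace B] [T2Space E] [T1Space B] [ConnectedSpace E] [SimplyConnectedSpace B]
    [LocallyPathConnectedSpace B] {p : E → B} (hp : IsLocalHomeomorph p) (hprop : IsProperMap p) :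
    Function.Bijective p := by
  have cov : IsCoveringMap p := by
    rw [isCoveringMap_iff_isCoveringMapOn_univ]
    refine hprop.isClosedMap.isCoveringMapOn_of_isLocalHomeomorphOn (fun b _ => ?_)
      (hp.isLocalHomeomorphOn.mono (Set.subset_univ _))
    refine (hprop.isCompact_preimage isCompact_singleton).finite
      (.of_openPartialHomeomorph p subset_rfl fun e _ => ?_)
    obtain ⟨q, hq, rfl⟩ := hp e
    exact ⟨q, hq, rfl⟩
  obtain ⟨e₀⟩ := (inferInstance : Nonempty E)
  obtain ⟨s, ⟨hs₀, hs⟩, -⟩ :=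
    cov.existsUnique_continuousMap_lifts (ContinuousMap.id B) (p e₀) e₀ rfl
  have left : s ∘ p = id := cov.eq_of_comp_eq (s.continuous.comp cov.continuous) continuous_id
    (by rw [← Function.comp_assoc, hs]; rfl) e₀ hs₀
  exact ⟨Function.LeftInverse.injective (congr_fun left),
    Function.RightInverse.surjective (congr_fun hs)⟩


/-- (Theorem 3.6, the main theorem of the paper.) Let `X`, `Y` be real Banach spaces,
`f : X → Y` a `C¹`-mapping and `η : Y → [0, ∞)` a `C¹`-functional such that:
(A1) `η(x) = 0 ↔ x = 0` and `η'(x) = 0 ↔ x = 0`;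
(A2) for every `y ∈ Y` the functional `φ(x) = η(f(x) − y)` satisfies the Palais–Smale
condition;
(A3) for every `x ∈ X` the Fréchet derivative `f'(x)` is a continuous linear bijection
from `X` onto `Y`. Then `f` is a diffeomorphism. -/
theorem global_diffeomorphism_banach
    {X Y : Type*} [NormedAddCommGroup X] [NormedSpace ℝ X] [CompleteSpace X]
    [NormedAddCommGroup Y] [NormedSpace ℝ Y] [CompleteSpace Y]
    (f : X → Y) (η : Y → ℝ)
    (hf : ContDiff ℝ 1 f)
    (hη : ContDiff ℝ 1 η)
    (hηpos : ∀ y : Y, 0 ≤ η y)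
    (hA1 : (∀ y : Y, η y = 0 ↔ y = 0) ∧ (∀ y : Y, fderiv ℝ η y = 0 ↔ y = 0))
    (hA2 : ∀ y : Y,
      ∀ u : ℕ → X,
        (∃ M : ℝ, ∀ n : ℕ, |η (f (u n) - y)| ≤ M) →
        Filter.Tendsto (fun n => ‖fderiv ℝ (fun x => η (f x - y)) (u n)‖)
          Filter.atTop (nhds 0) →
        ∃ v : X, ∃ φ : ℕ → ℕ, StrictMono φ ∧
          Filter.Tendsto (u ∘ φ) Filter.atTop (nhds v))
    (hA3 : ∀ x : X, Function.Bijective (fderiv ℝ f x)) :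
    Function.Bijective f ∧
      ∃ g : Y → X, Function.LeftInverse g f ∧ Function.RightInverse g f ∧
        ContDiff ℝ 1 g := by
  have hη0 : η 0 = 0 := (hA1.1 0).2 rfl
  have hprop : IsProperMap f := by
    refine isProperMap_iff_isCompact_preimage.2 ⟨hf.continuous, fun K hK => ?_⟩
    refine IsSeqCompact.isCompact fun x hx => ?_
    obtain ⟨y, hy, ψ, hψ, hlim⟩ := hK.tendsto_subseq hx
    have hJ : Filter.Tendsto (fun n => η (f (x (ψ n)) - y)) Filter.atTop (nhds 0) := by
      have := (hη.continuous.tendsto (y - y)).comp (hlim.sub_const y)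
      rwa [sub_self, hη0] at this
    obtain ⟨v, θ, hθ, hv⟩ := exists_tendsto_subseq_of_palaisSmale
      ((hη.comp (hf.sub contDiff_const)).differentiable one_ne_zero)
      (fun _ => hηpos _) (hA2 y) (x := x ∘ ψ) hJ
    refine ⟨v, ?_, ψ ∘ θ, hψ.comp hθ, hv⟩
    have hfv : f v = y := tendsto_nhds_unique ((hf.continuous.tendsto v).comp hv)
      (hlim.comp hθ.tendsto_atTop)
    rwa [Set.mem_preimage, hfv]
  let L (x : X) : X ≃L[ℝ] Y := ContinuousLinearEquiv.ofBijective (fderiv ℝ f x)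
    (LinearMap.ker_eq_bot.2 (hA3 x).1) (LinearMap.range_eq_top.2 (hA3 x).2)
  have hL (x : X) : HasFDerivAt f (L x : X →L[ℝ] Y) x :=
    (hf.differentiable one_ne_zero x).hasFDerivAt
  have hloc : IsLocalHomeomorph f := fun x =>
    ⟨hf.contDiffAt.toOpenPartialHomeomorph f (hL x) one_ne_zero,
      hf.contDiffAt.mem_toOpenPartialHomeomorph_source (hL x) one_ne_zero, rfl⟩
  have hbij := hloc.bijective_of_isProperMap hprop
  let e : X ≃ₜ Y := hloc.toHomeomorphOfBijective hbij
  exact ⟨hbij, e.symm, e.symm_apply_apply, e.apply_symm_apply, e.contDiff_symm hL hf⟩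
end

section
/- Let A be a nonzero n × n real matrix and let F : ℝⁿ → ℝⁿ be a C¹-mapping such that: (i) either there exists a constant a with 0 < a < δ_min(A) such that ‖F(x)‖ ≤ a‖x‖ for all x ∈ ℝⁿ of sufficiently large norm, or there exists a constant b > δ_max(A) such that ‖F(x)‖ ≥ b‖x‖ for all x ∈ ℝⁿ of sufficiently large norm; and (ii) det(A − F'(x)) ≠ 0 for every x ∈ ℝⁿ. Then for every ξ ∈ ℝⁿ the equation Ax − F(x) = ξ has exactly one solution x ∈ ℝⁿ. -/
open Filter

/-- A covering map from a nonempty connected space onto a simply connected and locally path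
connected space is a bijection. -/
theorem IsCoveringMap.bijective_of_simplyConnectedSpace {E X : Type*} [TopologicalSpace E]
    [TopologicalSpace X] [ConnectedSpace E] [SimplyConnectedSpace X] [LocallyPathConnectedSpace X]
    {p : E → X} (hp : IsCoveringMap p) : Function.Bijective p := by
  obtain ⟨e₀⟩ : Nonempty E := inferInstance
  obtain ⟨σ, ⟨hσ, hpσ⟩, -⟩ :=
    hp.existsUnique_continuousMap_lifts (ContinuousMap.id X) (p e₀) e₀ rfl
  have hright : Function.RightInverse σ p := fun x ↦ congrFun hpσ x
  have hleft : σ ∘ p = id :=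
    hp.eq_of_comp_eq (σ.continuous.comp hp.continuous) continuous_id
      (funext fun e ↦ hright (p e)) e₀ hσ
  exact ⟨Function.LeftInverse.injective (congrFun hleft), hright.surjective⟩

/-- A proper local homeomorphism between Hausdorff spaces is a covering map. -/
theorem IsLocalHomeomorph.isCoveringMap_of_isProperMap {E X : Type*} [TopologicalSpace E]
    [TopologicalSpace X] [T2Space E] {f : E → X} (hf : IsLocalHomeomorph f)
    (hproper : IsProperMap f) : IsCoveringMap f := by
  have hloc (e : E) : ∃ φ : OpenPartialHomeomorph E X, e ∈ φ.source ∧ φ = f :=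
    (hf e).imp fun φ h ↦ ⟨h.1, h.2.symm⟩
  refine isCoveringMap_iff_isCoveringMapOn_univ.2 <|
    hproper.isClosedMap.isCoveringMapOn_of_isLocalHomeomorphOn (fun x _ ↦ ?_) fun e _ ↦ hf e
  exact (hproper.isCompact_preimage isCompact_singleton).finite
    (IsDiscrete.of_openPartialHomeomorph f subset_rfl fun e _ ↦ hloc e)

/-- **Hadamard's global inverse function theorem**: a proper `C¹` self-map of a finite-dimensional
real normed space with everywhere invertible derivative is a bijection. -/
theorem ContDiff.bijective_of_isProperMap {E : Type*} [NormedAddCommGroup E] [NormedSpace ℝ E]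
    [FiniteDimensional ℝ E] {f : E → E} (hf : ContDiff ℝ 1 f)
    (hdet : ∀ x, LinearMap.det (fderiv ℝ f x : E →ₗ[ℝ] E) ≠ 0) (hproper : IsProperMap f) :
    Function.Bijective f := by
  have : CompleteSpace E := FiniteDimensional.complete ℝ E
  have hloc : IsLocalHomeomorph f := fun x ↦ by
    have hx : HasStrictFDerivAt f
        ((fderiv ℝ f x).toContinuousLinearEquivOfDetNeZero (hdet x) : E →L[ℝ] E) x := by
      simpa using hf.contDiffAt.hasStrictFDerivAt one_ne_zero
    exact ⟨hx.toOpenPartialHomeomorph f, hx.mem_toOpenPartialHomeomorph_source, rfl⟩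
  exact (hloc.isCoveringMap_of_isProperMap hproper).bijective_of_simplyConnectedSpace

/-- A continuous map that grows at least linearly is proper. -/
theorem Continuous.isProperMap_of_mul_norm_le {E E' : Type*} [NormedAddCommGroup E]
    [NormedAddCommGroup E'] [ProperSpace E] [ProperSpace E'] {f : E → E'} (hf : Continuous f)
    {c R : ℝ} (hc : 0 < c) (h : ∀ x, R ≤ ‖x‖ → c * ‖x‖ ≤ ‖f x‖) : IsProperMap f := by
  refine isProperMap_iff_tendsto_cocompact.2 ⟨hf, ?_⟩
  rw [← Metric.cobounded_eq_cocompact, ← Metric.cobounded_eq_cocompact,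
    ← tendsto_norm_atTop_iff_cobounded]
  refine tendsto_atTop_mono' _ ?_ (tendsto_norm_cobounded_atTop.const_mul_atTop hc)
  filter_upwards [tendsto_norm_cobounded_atTop.eventually_ge_atTop R] with x hx using h x hx

section UnitSphere

variable {E E' : Type*} [NormedAddCommGroup E] [NormedSpace ℝ E] [NormedAddCommGroup E']
  [NormedSpace ℝ E']

theorem LinearMap.norm_map_inv_norm_smul_mul_norm (L : E →ₗ[ℝ] E') (x : E) :
    ‖L (‖x‖⁻¹ • x)‖ * ‖x‖ = ‖L x‖ := by
  rcases eq_or_ne x 0 with rfl | hx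
  · simp
  · rw [map_smul, norm_smul, norm_inv, norm_norm]
    field_simp [norm_ne_zero_iff.2 hx]

theorem inv_norm_smul_mem_unit_sphere {x : E} (hx : x ≠ 0) :
    ‖x‖⁻¹ • x ∈ Metric.sphere (0 : E) 1 := by
  simpa using norm_smul_inv_norm (𝕜 := ℝ) hx

theorem LinearMap.sInf_norm_image_sphere_mul_norm_le (L : E →ₗ[ℝ] E') (x : E) :
    sInf ((fun y ↦ ‖L y‖) '' Metric.sphere (0 : E) 1) * ‖x‖ ≤ ‖L x‖ := by
  rcases eq_or_ne x 0 with rfl | hx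
  · simp
  rw [← L.norm_map_inv_norm_smul_mul_norm x]
  gcongr
  refine csInf_le ⟨0, ?_⟩ ⟨_, inv_norm_smul_mem_unit_sphere hx, rfl⟩
  rintro _ ⟨y, -, rfl⟩
  exact norm_nonneg _

theorem LinearMap.norm_le_sSup_norm_image_sphere_mul_norm [FiniteDimensional ℝ E]
    (L : E →ₗ[ℝ] E') (x : E) :
    ‖L x‖ ≤ sSup ((fun y ↦ ‖L y‖) '' Metric.sphere (0 : E) 1) * ‖x‖ := by
  have : ProperSpace E := FiniteDimensional.proper ℝ E
  rcases eq_or_ne x 0 with rfl | hx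
  · simp
  rw [← L.norm_map_inv_norm_smul_mul_norm x]
  gcongr
  exact le_csSup ((isCompact_sphere (0 : E) 1).bddAbove_image
    L.continuous_of_finiteDimensional.norm.continuousOn)
    ⟨_, inv_norm_smul_mem_unit_sphere hx, rfl⟩

end UnitSphere

/-- (Theorem 4.1 of the paper.) Let `A` be a nonzero `n × n` real matrix and
`F : ℝⁿ → ℝⁿ` a `C¹`-mapping such that:
(i) either there exists `0 < a < δ_min(A)` with `‖F(x)‖ ≤ a‖x‖` for all `x` of
sufficiently large norm, or there exists `b > δ_max(A)` with `‖F(x)‖ ≥ b‖x‖` for all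
`x` of sufficiently large norm; and (ii) `det(A − F'(x)) ≠ 0` for every `x ∈ ℝⁿ`.
Then for every `ξ ∈ ℝⁿ` the equation `Ax − F(x) = ξ` has exactly one solution.
Here `ℝⁿ` carries the Euclidean norm and the smallest/largest singular values are
characterized variationally as `δ_min(A) = inf_{‖x‖=1} ‖Ax‖`, `δ_max(A) = sup_{‖x‖=1} ‖Ax‖`. -/
theorem algebraic_equation_unique_solution
    {n : ℕ} (A : Matrix (Fin n) (Fin n) ℝ) (hA : A ≠ 0)
    (F : EuclideanSpace ℝ (Fin n) → EuclideanSpace ℝ (Fin n))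
    (hF : ContDiff ℝ 1 F)
    (hi :
      (∃ a : ℝ, 0 < a ∧
          a < sInf ((fun x : EuclideanSpace ℝ (Fin n) => ‖Matrix.toEuclideanLin A x‖) ''
            Metric.sphere (0 : EuclideanSpace ℝ (Fin n)) 1) ∧
          ∃ R : ℝ, ∀ x : EuclideanSpace ℝ (Fin n), R ≤ ‖x‖ → ‖F x‖ ≤ a * ‖x‖) ∨
      (∃ b : ℝ,
          sSup ((fun x : EuclideanSpace ℝ (Fin n) => ‖Matrix.toEuclideanLin A x‖) ''
            Metric.sphere (0 : EuclideanSpace ℝ (Fin n)) 1) < b ∧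
          ∃ R : ℝ, ∀ x : EuclideanSpace ℝ (Fin n), R ≤ ‖x‖ → b * ‖x‖ ≤ ‖F x‖))
    (hii : ∀ x : EuclideanSpace ℝ (Fin n),
      LinearMap.det (Matrix.toEuclideanLin A - (fderiv ℝ F x : _ →L[ℝ] _).toLinearMap) ≠ 0) :
    ∀ ξ : EuclideanSpace ℝ (Fin n),
      ∃! x : EuclideanSpace ℝ (Fin n), Matrix.toEuclideanLin A x - F x = ξ := by
  intro ξ
  set L := Matrix.toEuclideanLin A
  have hG : ContDiff ℝ 1 fun x ↦ L x - F x :=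
    (LinearMap.toContinuousLinearMap L).contDiff.sub hF
  have hfderiv (x) : fderiv ℝ (fun x ↦ L x - F x) x = LinearMap.toContinuousLinearMap L -
      fderiv ℝ F x :=
    ((LinearMap.toContinuousLinearMap L).hasFDerivAt.sub
      (hF.differentiable one_ne_zero x).hasFDerivAt).fderiv
  have hproper : IsProperMap fun x ↦ L x - F x := by
    rcases hi with ⟨a, -, ha, R, h⟩ | ⟨b, hb, R, h⟩
    · refine hG.continuous.isProperMap_of_mul_norm_le (sub_pos.2 ha) (R := R) fun x hx ↦ ?_
      linarith [L.sInf_norm_image_sphere_mul_norm_le x, h x hx, norm_sub_norm_le (L x) (F x)]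
    · refine hG.continuous.isProperMap_of_mul_norm_le (sub_pos.2 hb) (R := R) fun x hx ↦ ?_
      linarith [L.norm_le_sSup_norm_image_sphere_mul_norm x, h x hx,
        norm_sub_norm_le (F x) (L x), norm_sub_rev (L x) (F x)]
  refine (hG.bijective_of_isProperMap (fun x ↦ ?_) hproper).existsUnique ξ
  rw [hfderiv x]
  exact hii x
end
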